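/- arXiv:math/0611490 — 2 statements merged into one kernel-verified Lean document; each statement's English description precedes it below -/
import Mathlib

section
/- (Main theorem, case n ≥ 2k+1) Let k ≥ 3 and n ≥ 2k+1. Every edge coloring of the complete graph K_n using at least max{(2k-3 choose 2), (k-2 choose 2) + (k-2)(n-k+2)} + 2 colors contains a rainbow matching of size k. -/
/-- The number of colors used by an edge coloring `c` of the complete graph on `Fin n`:
the cardinality of the image of `c` on the edge set. -/
def numColors {n : ℕ} (c : Sym2 (Fin n) → ℕ) : ℕ :=
  (((⊤ : SimpleGraph (Fin n)).edgeFinset).image c).card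

/-- The coloring `c` of the complete graph on `Fin n` admits a rainbow matching of size `k`:
`k` pairwise disjoint edges with pairwise distinct colors. -/
def HasRainbowMatching {n : ℕ} (c : Sym2 (Fin n) → ℕ) (k : ℕ) : Prop :=
  ∃ s : Finset (Sym2 (Fin n)), s.card = k ∧ (∀ e ∈ s, ¬ e.IsDiag) ∧
    ((s : Set (Sym2 (Fin n))).Pairwise fun e f => ∀ v, v ∈ e → v ∉ f) ∧
    Set.InjOn c ↑s

/-- A finite set of edges is a matching if it contains no loops and its members are pairwise
disjoint. -/
def IsMatchingSet {V : Type*} (M : Finset (Sym2 V)) : Prop :=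
  (∀ e ∈ M, ¬ e.IsDiag) ∧ (M : Set (Sym2 V)).Pairwise fun e f => ∀ v, v ∈ e → v ∉ f

/-- The graph on `W` with edge set `E`, joined completely to `r` new vertices, which are also
pairwise adjacent. -/
def joinedGraph {V : Type*} (W : Finset V) (E : Finset (Sym2 V)) (r : ℕ) :
    SimpleGraph (W ⊕ Fin r) where
  Adj x y := x ≠ y ∧ ∀ a b, x = Sum.inl a → y = Sum.inl b → s(a.1, b.1) ∈ E
  symm := ⟨fun x y h => ⟨h.1.symm, fun a b ha hb => by
    have := h.2 b a hb ha
    rwa [Sym2.eq_swap]⟩⟩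
  loopless := ⟨fun x h => h.1 rfl⟩

open Classical in
lemma joinedGraph_not_isPerfectMatching {V : Type*} (W : Finset V) (E : Finset (Sym2 V))
    (hE : ∀ e ∈ E, ¬ e.IsDiag) (k r : ℕ) (hk : 2 * k + r = W.card)
    (hno : ∀ M ⊆ E, IsMatchingSet M → M.card < k) (M : (joinedGraph W E r).Subgraph) :
    ¬ M.IsPerfectMatching := by
  intro hM
  rw [SimpleGraph.Subgraph.isPerfectMatching_iff] at hM
  choose p hp hpu using hM
  set M' := E.filter fun e => ∃ a b : W, e = s(a.1, b.1) ∧ M.Adj (Sum.inl a) (Sum.inl b) with hM'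
  have hmatch : IsMatchingSet M' := by
    refine ⟨fun e he => hE e (Finset.mem_filter.1 he).1, ?_⟩
    intro e he e' he' hne v hv hv'
    obtain ⟨-, a, b, rfl, hab⟩ := Finset.mem_filter.1 he
    obtain ⟨-, a', b', rfl, hab'⟩ := Finset.mem_filter.1 he'
    apply hne
    have key : ∀ x y z : W, M.Adj (Sum.inl x) (Sum.inl y) → M.Adj (Sum.inl x) (Sum.inl z) →
        y = z := fun x y z h h' => Sum.inl_injective ((hpu _ _ h).trans (hpu _ _ h').symm)
    rw [Sym2.mem_iff] at hv hv'
    rcases hv with rfl | rfl <;> rcases hv' with h | h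
    · obtain rfl := Subtype.ext h
      rw [key _ _ _ hab hab']
    · obtain rfl := Subtype.ext h
      rw [key _ _ _ hab hab'.symm, Sym2.eq_swap]
    · obtain rfl := Subtype.ext h
      rw [key _ _ _ hab.symm hab', Sym2.eq_swap]
    · obtain rfl := Subtype.ext h
      rw [key _ _ _ hab.symm hab'.symm]
  have hlt := hno M' (Finset.filter_subset _ _) hmatch
  have hcov : W ⊆ (Finset.univ : Finset (Fin r)).biUnion (fun j =>
      match p (Sum.inr j) with
      | Sum.inl a => {a.1}
      | Sum.inr _ => ∅) ∪ M'.biUnion Sym2.toFinset := by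
    intro v hv
    rw [Finset.mem_union, Finset.mem_biUnion, Finset.mem_biUnion]
    rcases h : p (Sum.inl ⟨v, hv⟩) with b | j
    · right
      have hadj := hp (Sum.inl ⟨v, hv⟩)
      simp only [h] at hadj
      refine ⟨s(v, b.1), Finset.mem_filter.2 ⟨?_, ⟨v, hv⟩, b, rfl, hadj⟩, by simp⟩
      exact hadj.adj_sub.2 ⟨v, hv⟩ b rfl rfl
    · left
      refine ⟨j, Finset.mem_univ _, ?_⟩
      have hadj := hp (Sum.inl ⟨v, hv⟩)
      simp only [h] at hadj
      have := hpu _ _ hadj.symm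
      rw [← this]
      simp
  have h1 := Finset.card_le_card hcov
  have h2 := Finset.card_union_le ((Finset.univ : Finset (Fin r)).biUnion (fun j =>
      match p (Sum.inr j) with
      | Sum.inl a => {a.1}
      | Sum.inr _ => ∅)) (M'.biUnion Sym2.toFinset)
  have h3 : ((Finset.univ : Finset (Fin r)).biUnion (fun j =>
      match p (Sum.inr j) with
      | Sum.inl a => {a.1}
      | Sum.inr _ => (∅ : Finset V))).card ≤ r := by
    refine (Finset.card_biUnion_le_card_mul _ _ 1 ?_).trans (by simp)
    intro j _
    split <;> simp
  have h4 : (M'.biUnion Sym2.toFinset).card ≤ M'.card * 2 := by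
    refine Finset.card_biUnion_le_card_mul _ _ 2 ?_
    intro e he
    rw [Sym2.card_toFinset]
    split <;> simp
  omega

open Classical in
/-- The Tutte–Berge formula, in the form of a barrier for a graph on `W` without a matching of
size `k`. -/
theorem exists_barrier {V : Type*} (W : Finset V) (E : Finset (Sym2 V))
    (hE : ∀ e ∈ E, ¬ e.IsDiag) (k : ℕ) (hk : 2 * k ≤ W.card)
    (hno : ∀ M ⊆ E, IsMatchingSet M → M.card < k) :
    ∃ S ⊆ W, ∃ (f : V → Set V) (O : Finset (Set V)),
      (∀ a ∈ W \ S, ∀ b ∈ W \ S, s(a, b) ∈ E → f a = f b) ∧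
      S.card + W.card + 2 ≤ O.card + 2 * k ∧
      ∀ o ∈ O, Odd ((W \ S).filter fun v => f v = o).card := by
  obtain ⟨r, hr⟩ := Nat.exists_eq_add_of_le hk
  have hnot : ¬ ∃ M : (joinedGraph W E r).Subgraph, M.IsPerfectMatching := fun ⟨M, hM⟩ =>
    joinedGraph_not_isPerfectMatching W E hE k r hr.symm hno M hM
  rw [SimpleGraph.tutte] at hnot
  push Not at hnot
  obtain ⟨u, hu⟩ := hnot
  unfold SimpleGraph.IsTutteViolator at hu
  set H := ((⊤ : (joinedGraph W E r).Subgraph).deleteVerts u).coe with hH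
  have hverts : ((⊤ : (joinedGraph W E r).Subgraph).deleteVerts u).verts = uᶜ := by
    ext; simp
  have hcard : Nat.card ((⊤ : (joinedGraph W E r).Subgraph).deleteVerts u).verts + u.ncard
      = W.card + r := by
    rw [hverts]
    have := Set.ncard_add_ncard_compl u
    rw [Nat.card_eq_fintype_card] at this
    simp only [Fintype.card_sum, Fintype.card_coe, Fintype.card_fin] at this
    rw [Nat.card_coe_set_eq]
    omega
  have hpar := SimpleGraph.odd_ncard_oddComponents H
  by_cases hinr : ∃ j, (Sum.inr j : W ⊕ Fin r) ∉ u
  · exfalso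
    obtain ⟨j, hj⟩ := hinr
    have hsub : H.oddComponents.ncard ≤ 1 := by
      rw [Set.ncard_le_one (Set.toFinite _)]
      have hj' : (Sum.inr j : W ⊕ Fin r) ∈ ((⊤ : (joinedGraph W E r).Subgraph).deleteVerts u).verts := by
        rw [hverts]; exact hj
      have key : ∀ C : H.ConnectedComponent, C = H.connectedComponentMk ⟨_, hj'⟩ := by
        intro C
        induction C using SimpleGraph.ConnectedComponent.ind with
        | _ v =>
        by_cases hv : v = ⟨_, hj'⟩
        · rw [hv]
        · apply SimpleGraph.ConnectedComponent.sound
          apply SimpleGraph.Adj.reachable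
          rw [hH, SimpleGraph.Subgraph.coe_adj, SimpleGraph.Subgraph.deleteVerts_adj]
          have hv2 : v.1 ∈ uᶜ := hverts.subset v.2
          refine ⟨by simp, hv2, by simp, hj, ?_⟩
          rw [SimpleGraph.Subgraph.top_adj]
          refine ⟨fun h => hv (Subtype.ext h), fun a b _ h => by simp at h⟩
      intro a _ b _
      rw [key a, key b]
    have h1 : H.oddComponents.ncard = 1 := by omega
    rw [h1] at hpar
    have := hpar.1 (by decide)
    obtain ⟨t, ht⟩ := this
    omega
  · push Not at hinr
    set S := W.filter fun v => ∃ h : v ∈ W, (Sum.inl ⟨v, h⟩ : W ⊕ Fin r) ∈ u with hS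
    have hucard : u.ncard = S.card + r := by
      have : u = ((S.attach.image fun v => (Sum.inl ⟨v.1, (Finset.mem_filter.1 v.2).1⟩ : W ⊕ Fin r)) ∪
          (Finset.univ.image Sum.inr) : Finset (W ⊕ Fin r)) := by
        ext x
        rcases x with x | x
        · simp only [Finset.coe_union, Finset.coe_image, Set.mem_union, Set.mem_image,
            reduceCtorEq, and_false, exists_false, or_false, Sum.inl.injEq]
          constructor
          · intro hx
            exact ⟨⟨x.1, Finset.mem_filter.2 ⟨x.2, x.2, hx⟩⟩, by simp, rfl⟩
          · rintro ⟨a, -, rfl⟩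
            exact (Finset.mem_filter.1 a.2).2.choose_spec
        · simp [hinr]
      rw [this, Set.ncard_coe_finset, Finset.card_union_of_disjoint, Finset.card_image_of_injective,
        Finset.card_image_of_injective, Finset.card_attach, Finset.card_univ, Fintype.card_fin]
      · exact Sum.inr_injective
      · intro a b hab
        simp only [Sum.inl.injEq, Subtype.mk.injEq] at hab
        exact Subtype.ext hab
      · rw [Finset.disjoint_left]
        intro x hx hx'
        simp only [Finset.mem_image] at hx hx'
        obtain ⟨_, _, rfl⟩ := hx
        obtain ⟨_, _, h⟩ := hx'
        simp at h
    have hmemS : ∀ v (hv : v ∈ W \ S), (Sum.inl ⟨v, (Finset.mem_sdiff.1 hv).1⟩ : W ⊕ Fin r) ∈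
        ((⊤ : (joinedGraph W E r).Subgraph).deleteVerts u).verts := by
      intro v hv
      rw [hverts]
      intro h
      exact (Finset.mem_sdiff.1 hv).2 (Finset.mem_filter.2 ⟨(Finset.mem_sdiff.1 hv).1, _, h⟩)
    let g : H.ConnectedComponent → Set V := fun C => {v | ∃ hv : v ∈ W \ S,
      H.connectedComponentMk ⟨_, hmemS v hv⟩ = C}
    have hg : ∀ C : H.ConnectedComponent, C.supp.ncard = (g C).ncard := by
      intro C
      have hval : ∀ x : ((⊤ : (joinedGraph W E r).Subgraph).deleteVerts u).verts,
          ∃ v, ∃ hv : v ∈ W \ S, x = ⟨_, hmemS v hv⟩ := by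
        rintro ⟨x | x, hx⟩
        · refine ⟨x.1, ?_, rfl⟩
          rw [hverts] at hx
          rw [Finset.mem_sdiff]
          refine ⟨x.2, fun h => hx ?_⟩
          obtain ⟨_, _, h⟩ := Finset.mem_filter.1 h
          exact h
        · rw [hverts] at hx
          exact absurd (hinr x) hx
      symm
      apply Set.ncard_congr (fun v hv => ⟨_, hmemS v hv.choose⟩)
      · intro v hv
        exact hv.choose_spec
      · intro a b ha hb h
        simpa [Subtype.ext_iff] using h
      · intro x hx
        obtain ⟨v, hv, rfl⟩ := hval x
        exact ⟨v, ⟨hv, hx⟩, rfl⟩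
    have hodd : ∀ C ∈ H.oddComponents, Odd (g C).ncard := by
      intro C hC
      rw [← hg]
      exact hC
    have hginj : Set.InjOn g H.oddComponents := by
      intro C hC D hD h
      have : (g C).Nonempty := by
        rw [Set.nonempty_iff_ne_empty]
        intro h0
        have := hodd C hC
        rw [h0] at this
        simp at this
      obtain ⟨v, hv⟩ := this
      have hv' := hv
      rw [h] at hv'
      exact hv.choose_spec.symm.trans hv'.choose_spec
    let f : V → Set V := fun v => if hv : v ∈ W \ S then g (H.connectedComponentMk ⟨_, hmemS v hv⟩)
      else ∅
    refine ⟨S, Finset.filter_subset _ _, f, H.oddComponents.toFinset.image g, ?_, ?_, ?_⟩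
    · intro a ha b hb hab
      simp only [f, dif_pos ha, dif_pos hb]
      congr 1
      apply SimpleGraph.ConnectedComponent.sound
      apply SimpleGraph.Adj.reachable
      rw [hH, SimpleGraph.Subgraph.coe_adj, SimpleGraph.Subgraph.deleteVerts_adj]
      have ha' := hmemS a ha
      have hb' := hmemS b hb
      rw [hverts] at ha' hb'
      refine ⟨by simp, ha', by simp, hb', ?_⟩
      rw [SimpleGraph.Subgraph.top_adj]
      refine ⟨?_, ?_⟩
      · intro h
        have h' : a = b := by simpa using h
        exact hE _ hab (by simp [h'])
      · rintro ⟨x, _⟩ ⟨y, _⟩ hx hy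
        have hx' : a = x := by simpa using hx
        have hy' : b = y := by simpa using hy
        subst hx' hy'
        exact hab
    · rw [Finset.card_image_of_injOn (by simpa using hginj), ← Set.ncard_eq_toFinset_card']
      have hiff : Odd H.oddComponents.ncard ↔ Odd (W.card - S.card) := by
        rw [hpar]
        have hle := Finset.card_le_card (Finset.filter_subset (fun v => ∃ h : v ∈ W, (Sum.inl ⟨v, h⟩ : W ⊕ Fin r) ∈ u) W)
        have : Nat.card ((⊤ : (joinedGraph W E r).Subgraph).deleteVerts u).verts = W.card - S.card := by
          omega
        rw [this]
      have hle : S.card ≤ W.card := Finset.card_le_card (Finset.filter_subset _ W)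
      rw [Nat.odd_iff, Nat.odd_iff] at hiff
      omega
    · intro o ho
      obtain ⟨C, hC, rfl⟩ := Finset.mem_image.1 ho
      have hC' : C ∈ H.oddComponents := by simpa using hC
      have := hodd C hC'
      convert this using 1
      rw [← Set.ncard_coe_finset]
      congr 1
      ext v
      simp only [Finset.coe_filter, Set.mem_ofPred_eq]
      constructor
      · rintro ⟨hv, hfv⟩
        rw [← hfv]
        simp only [f, dif_pos hv]
        exact ⟨hv, rfl⟩
      · rintro ⟨hv, rfl⟩
        refine ⟨hv, ?_⟩
        simp only [f, dif_pos hv]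

lemma two_mul_succ_choose_two (a : ℕ) : 2 * (a + 1).choose 2 = (a + 1) * a := by
  rw [Nat.choose_two_right, Nat.mul_div_cancel' (Nat.even_mul_pred_self (a + 1)).two_dvd]
  simp

lemma sum_succ_choose_two_le {ι : Type*} (L : Finset ι) (x : ι → ℕ) :
    ∑ i ∈ L, (x i + 1).choose 2 ≤ (∑ i ∈ L, x i + 1).choose 2 := by
  classical
  induction L using Finset.induction_on with
  | empty => simp
  | insert a L ha ih =>
    rw [Finset.sum_insert ha, Finset.sum_insert ha]
    have h1 := two_mul_succ_choose_two (x a)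
    have h2 := two_mul_succ_choose_two (∑ i ∈ L, x i)
    have h3 := two_mul_succ_choose_two (x a + ∑ i ∈ L, x i)
    nlinarith [Nat.zero_le (x a * ∑ i ∈ L, x i)]

lemma sum_succ_choose_two_le_of_two_le {ι : Type*} (L : Finset ι) (x : ι → ℕ) {i j : ι}
    (hi : i ∈ L) (hj : j ∈ L) (hij : i ≠ j) (hxi : 2 ≤ x i) (hxj : 2 ≤ x j) :
    ∑ i ∈ L, (x i + 1).choose 2 ≤ (∑ i ∈ L, x i - 1).choose 2 + 3 := by
  classical
  rw [← Finset.add_sum_erase L _ hi, ← Finset.add_sum_erase L _ hi]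
  have h := sum_succ_choose_two_le (L.erase i) x
  have hle : x j ≤ ∑ l ∈ L.erase i, x l :=
    Finset.single_le_sum (fun _ _ => Nat.zero_le _) (Finset.mem_erase.2 ⟨hij.symm, hj⟩)
  generalize ∑ l ∈ L.erase i, x l = Y at *
  obtain ⟨p, hp⟩ := Nat.exists_eq_add_of_le hxi
  obtain ⟨q, rfl⟩ := Nat.exists_eq_add_of_le (hxj.trans hle)
  rw [hp]
  have h1 := two_mul_succ_choose_two (2 + p)
  have h2 := two_mul_succ_choose_two (2 + q)
  have h3 := two_mul_succ_choose_two (p + q + 2)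
  rw [show 2 + p + (2 + q) - 1 = p + q + 2 + 1 by omega]
  nlinarith [Nat.zero_le (p * q)]

/-- The Erdős–Gallai bound on the number of edges of a graph on `n` vertices without a matching
of size `m + 1`. -/
def erdosGallaiBound (n m : ℕ) : ℕ :=
  max ((2 * m + 1).choose 2) (m.choose 2 + m * (n - m))

section Counting

open Classical

variable {V : Type*}

/-- The edges of `E` with both ends in `T`. -/
noncomputable def edgesInside (E : Finset (Sym2 V)) (T : Finset V) : Finset (Sym2 V) :=
  E.filter fun e => ∀ v ∈ e, v ∈ T

lemma mem_edgesInside {E : Finset (Sym2 V)} {T : Finset V} {e : Sym2 V} :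
    e ∈ edgesInside E T ↔ e ∈ E ∧ ∀ v ∈ e, v ∈ T :=
  Finset.mem_filter

lemma card_edges_le_split (W S : Finset V) (E : Finset (Sym2 V))
    (hE : ∀ e ∈ E, ¬ e.IsDiag) (hEW : ∀ e ∈ E, ∀ v ∈ e, v ∈ W) :
    E.card ≤ S.card.choose 2 + ((S ×ˢ (W \ S)).filter fun p => s(p.1, p.2) ∈ E).card +
      (edgesInside E (W \ S)).card := by
  have hsub : E ⊆ (S.offDiag.image Sym2.mk.uncurry ∪
      ((S ×ˢ (W \ S)).filter fun p => s(p.1, p.2) ∈ E).image fun p => s(p.1, p.2)) ∪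
      (edgesInside E (W \ S)) := by
    intro e he
    have hd := hE e he
    have hw := hEW e he
    induction e using Sym2.ind with
    | _ a b =>
    have ha := hw a (by simp)
    have hb := hw b (by simp)
    simp only [Sym2.mk_isDiag_iff] at hd
    rw [Finset.mem_union, Finset.mem_union, Finset.mem_image, Finset.mem_image, mem_edgesInside]
    by_cases haS : a ∈ S <;> by_cases hbS : b ∈ S
    · exact Or.inl (Or.inl ⟨(a, b), by simp [haS, hbS, hd], rfl⟩)
    · exact Or.inl (Or.inr ⟨(a, b), by simp [haS, hbS, hb, he], rfl⟩)
    · refine Or.inl (Or.inr ⟨(b, a), ?_, Sym2.eq_swap⟩)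
      rw [Sym2.eq_swap] at he
      simp [haS, hbS, ha, he]
    · refine Or.inr ⟨he, ?_⟩
      intro v hv
      rcases Sym2.mem_iff.1 hv with rfl | rfl <;> simp [*]
  refine (Finset.card_le_card hsub).trans ((Finset.card_union_le _ _).trans ?_)
  gcongr
  refine (Finset.card_union_le _ _).trans ?_
  rw [Sym2.card_image_offDiag]
  gcongr
  exact Finset.card_image_le

lemma card_edges_inside_le {ι : Type*} [DecidableEq ι] (T : Finset V) (E : Finset (Sym2 V))
    (hE : ∀ e ∈ E, ¬ e.IsDiag) (f : V → ι)
    (hf : ∀ a ∈ T, ∀ b ∈ T, s(a, b) ∈ E → f a = f b) :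
    (edgesInside E T).card ≤
      ∑ l ∈ T.image f, (T.filter fun v => f v = l).card.choose 2 := by
  have hsub : (edgesInside E T) ⊆
      (T.image f).biUnion fun l => (T.filter fun v => f v = l).offDiag.image Sym2.mk.uncurry := by
    intro e he
    obtain ⟨he, hT⟩ := mem_edgesInside.1 he
    have hd := hE e he
    induction e using Sym2.ind with
    | _ a b =>
    have ha := hT a (by simp)
    have hb := hT b (by simp)
    simp only [Sym2.mk_isDiag_iff] at hd
    have := hf a ha b hb he
    refine Finset.mem_biUnion.2 ⟨f a, Finset.mem_image_of_mem f ha, ?_⟩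
    exact Finset.mem_image.2 ⟨(a, b), by simp [*], rfl⟩
  refine (Finset.card_le_card hsub).trans (Finset.card_biUnion_le.trans ?_)
  refine Finset.sum_le_sum fun l _ => ?_
  rw [Sym2.card_image_offDiag]

lemma sum_card_fiber_sub_one {ι : Type*} [DecidableEq ι] (T : Finset V) (f : V → ι) :
    ∑ l ∈ T.image f, ((T.filter fun v => f v = l).card - 1) + (T.image f).card = T.card := by
  rw [Finset.card_eq_sum_card_image f T, Finset.card_eq_sum_ones, ← Finset.sum_add_distrib]
  refine Finset.sum_congr rfl fun l hl => ?_
  obtain ⟨v, hv, rfl⟩ := Finset.mem_image.1 hl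
  have : 0 < (T.filter fun w => f w = f v).card :=
    Finset.card_pos.2 ⟨v, Finset.mem_filter.2 ⟨hv, rfl⟩⟩
  omega

lemma sum_fiber_choose_two {ι : Type*} [DecidableEq ι] (T : Finset V) (f : V → ι) :
    ∑ l ∈ T.image f, (T.filter fun v => f v = l).card.choose 2 =
      ∑ l ∈ T.image f, ((T.filter fun v => f v = l).card - 1 + 1).choose 2 := by
  refine Finset.sum_congr rfl fun l hl => ?_
  obtain ⟨v, hv, rfl⟩ := Finset.mem_image.1 hl
  have : 0 < (T.filter fun w => f w = f v).card :=
    Finset.card_pos.2 ⟨v, Finset.mem_filter.2 ⟨hv, rfl⟩⟩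
  congr 1
  omega

lemma barrier_bound_le_max {n m s : ℕ} (hs : s ≤ m) (hn : 2 * m + 2 ≤ n) :
    s.choose 2 + s * (n - s) + (2 * m - 2 * s + 1).choose 2 ≤ erdosGallaiBound n m := by
  obtain ⟨t, rfl⟩ := Nat.exists_eq_add_of_le hs
  obtain ⟨d, rfl⟩ := Nat.exists_eq_add_of_le hn
  unfold erdosGallaiBound
  rcases Nat.eq_zero_or_pos s with rfl | hs0
  · simp
  rcases Nat.eq_zero_or_pos t with rfl | ht0
  · simp
  obtain ⟨s, rfl⟩ := Nat.exists_eq_add_of_le' hs0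
  obtain ⟨t, rfl⟩ := Nat.exists_eq_add_of_le' ht0
  have h1 := two_mul_succ_choose_two s
  have h2 := two_mul_succ_choose_two (2 * (t + 1))
  have h3 := two_mul_succ_choose_two (2 * (s + 1 + (t + 1)))
  have h4 := two_mul_succ_choose_two (s + 1 + t)
  rw [show 2 * (s + 1 + (t + 1)) - 2 * (s + 1) + 1 = 2 * (t + 1) + 1 by omega,
    show 2 * (s + 1 + (t + 1)) + 2 + d - (s + 1) = s + 2 * t + 5 + d by omega,
    show 2 * (s + 1 + (t + 1)) + 2 + d - (s + 1 + (t + 1)) = s + t + 4 + d by omega,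
    show s + 1 + (t + 1) = s + 1 + t + 1 by omega] at *
  rw [le_max_iff]
  by_contra! hcon
  obtain ⟨hA, hB⟩ := hcon
  have e1 : (s + 1) * (5 * (s + 1) + 8 * (t + 1) + 3) <
      (s + 1) * (2 * (2 * (s + 1 + (t + 1)) + 2 + d)) := by
    nlinarith
  have e2 : (t + 1) * (2 * (2 * (s + 1 + (t + 1)) + 2 + d)) <
      (t + 1) * (5 * (t + 1) + 2 * (s + 1) + 3) := by
    nlinarith
  have e1' := Nat.lt_of_mul_lt_mul_left e1
  have e2' := Nat.lt_of_mul_lt_mul_left e2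
  omega

/-- The Erdős–Gallai theorem. -/
theorem card_le_erdosGallaiBound (W : Finset V) (E : Finset (Sym2 V))
    (hE : ∀ e ∈ E, ¬ e.IsDiag) (hEW : ∀ e ∈ E, ∀ v ∈ e, v ∈ W) (m : ℕ)
    (hm : 2 * m + 2 ≤ W.card) (hno : ∀ M ⊆ E, IsMatchingSet M → M.card ≤ m) :
    E.card ≤ erdosGallaiBound W.card m := by
  obtain ⟨S, hSW, f, O, hf, hcard, hO⟩ := exists_barrier W E hE (m + 1) (by omega)
    fun M hM hM' => Nat.lt_succ_of_le (hno M hM hM')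
  have h1 := card_edges_le_split W S E hE hEW
  have h2 := card_edges_inside_le (W \ S) E hE f hf
  have h3 := sum_card_fiber_sub_one (W \ S) f
  rw [sum_fiber_choose_two] at h2
  have h4 := sum_succ_choose_two_le ((W \ S).image f)
    fun l => (((W \ S).filter fun v => f v = l).card - 1)
  have h5 : O ⊆ (W \ S).image f := by
    intro o ho
    have : 0 < ((W \ S).filter fun v => f v = o).card := (hO o ho).pos
    obtain ⟨v, hv⟩ := Finset.card_pos.1 this
    obtain ⟨hv, hfv⟩ := Finset.mem_filter.1 hv
    exact Finset.mem_image.2 ⟨v, hv, hfv⟩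
  have h6 := Finset.card_le_card h5
  have h7 := Finset.card_sdiff_add_card_eq_card hSW
  have h8 : ((S ×ˢ (W \ S)).filter fun p => s(p.1, p.2) ∈ E).card ≤ S.card * (W.card - S.card) := by
    refine (Finset.card_filter_le _ _).trans ?_
    rw [Finset.card_product, Finset.card_sdiff_of_subset hSW]
  have h9 : (∑ l ∈ (W \ S).image f, (((W \ S).filter fun v => f v = l).card - 1) + 1).choose 2 ≤
      (2 * m - 2 * S.card + 1).choose 2 := by
    apply Nat.choose_le_choose
    omega
  have h10 := barrier_bound_le_max (n := W.card) (m := m) (s := S.card) (by omega) hm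
  omega

end Counting

section Matchings

open Classical

variable {V : Type*}

lemma IsMatchingSet.mono {M N : Finset (Sym2 V)} (hN : IsMatchingSet N) (h : M ⊆ N) :
    IsMatchingSet M :=
  ⟨fun e he => hN.1 e (h he), fun _ he _ hf hne => hN.2 (h he) (h hf) hne⟩

lemma IsMatchingSet.union {M N : Finset (Sym2 V)} (hM : IsMatchingSet M) (hN : IsMatchingSet N)
    (h : ∀ e ∈ M, ∀ f ∈ N, ∀ v ∈ e, v ∉ f) : IsMatchingSet (M ∪ N) := by
  refine ⟨fun e he => (Finset.mem_union.1 he).elim (hM.1 e) (hN.1 e), ?_⟩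
  intro e he f hf hne v hv hvf
  rcases Finset.mem_union.1 he with he | he <;> rcases Finset.mem_union.1 hf with hf | hf
  · exact hM.2 he hf hne v hv hvf
  · exact h e he f hf v hv hvf
  · exact h f hf e he v hvf hv
  · exact hN.2 he hf hne v hv hvf

lemma isMatchingSet_singleton {x y : V} (h : x ≠ y) : IsMatchingSet {s(x, y)} := by
  refine ⟨by simpa using h, ?_⟩
  simp

lemma IsMatchingSet.insert {M : Finset (Sym2 V)} (hM : IsMatchingSet M) {x y : V} (h : x ≠ y)
    (hx : ∀ e ∈ M, x ∉ e) (hy : ∀ e ∈ M, y ∉ e) : IsMatchingSet (insert s(x, y) M) := by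
  rw [Finset.insert_eq]
  refine (isMatchingSet_singleton h).union hM ?_
  intro e he f hf v hv
  rw [Finset.mem_singleton.1 he, Sym2.mem_iff] at hv
  rcases hv with rfl | rfl
  exacts [hx f hf, hy f hf]

lemma IsMatchingSet.eq_of_mem {M : Finset (Sym2 V)} (hM : IsMatchingSet M) {e f : Sym2 V}
    (he : e ∈ M) (hf : f ∈ M) {v : V} (hve : v ∈ e) (hvf : v ∈ f) : e = f := by
  by_contra hne
  exact hM.2 he hf hne v hve hvf

/-- If every edge meeting `I` has its other end in `S`, a matching covers at most `#S` vertices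
of `I`. -/
lemma IsMatchingSet.card_covered_le {M : Finset (Sym2 V)} (hM : IsMatchingSet M) (I S : Finset V)
    (hdis : Disjoint I S) (h : ∀ x ∈ I, ∀ e ∈ M, x ∈ e → ∃ a ∈ S, e = s(x, a)) :
    (I.filter fun x => ∃ e ∈ M, x ∈ e).card ≤ S.card := by
  have : ∀ x ∈ I.filter fun x => ∃ e ∈ M, x ∈ e, ∃ a ∈ S, s(x, a) ∈ M := by
    intro x hx
    obtain ⟨hx, e, he, hxe⟩ := Finset.mem_filter.1 hx
    obtain ⟨a, ha, rfl⟩ := h x hx e he hxe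
    exact ⟨a, ha, he⟩
  choose! g hg hgM using this
  refine Finset.card_le_card_of_injOn g hg ?_
  intro x hx y hy hxy
  have h1 := hgM x hx
  have h2 := hgM y hy
  rw [hxy] at h1
  have h3 := hM.eq_of_mem h1 h2 (Sym2.mem_mk_right x (g y)) (Sym2.mem_mk_right y (g y))
  have h4 : x ∈ s(y, g y) := h3 ▸ Sym2.mem_mk_left x (g y)
  rcases Sym2.mem_iff.1 h4 with h | h
  · exact h
  · have hxI := (Finset.mem_filter.1 hx).1
    have hyS := hg y hy
    rw [← h] at hyS
    exact absurd hyS (Finset.disjoint_left.1 hdis hxI)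

/-- If fewer than `#J` pairs between `S` and `J` are non-edges, then `S` can be matched
into `J`. -/
lemma exists_matching_of_card_missing_lt (S J : Finset V) (E : Finset (Sym2 V))
    (hdis : Disjoint S J) (hle : S.card ≤ J.card)
    (hmiss : ((S ×ˢ J).filter fun p => s(p.1, p.2) ∉ E).card < J.card) :
    ∃ M ⊆ E, IsMatchingSet M ∧ M.card = S.card ∧ ∀ e ∈ M, ∃ a ∈ S, ∃ b ∈ J, e = s(a, b) := by
  have hall := (Finset.all_card_le_biUnion_card_iff_exists_injective
    (fun a : S => J.filter fun b => s(a.1, b) ∈ E)).1 ?_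
  · obtain ⟨g, hginj, hg⟩ := hall
    have hgJ : ∀ a, g a ∈ J := fun a => (Finset.mem_filter.1 (hg a)).1
    have hgE : ∀ a, s(a.1, g a) ∈ E := fun a => (Finset.mem_filter.1 (hg a)).2
    have hne : ∀ a b : S, a.1 ≠ g b := fun a b h =>
      Finset.disjoint_left.1 hdis a.2 (h ▸ hgJ b)
    have key : ∀ (a b : S) (v : V), v ∈ s(a.1, g a) → v ∈ s(b.1, g b) → a = b := by
      intro a b v ha hb
      rcases Sym2.mem_iff.1 ha with h | h <;> rcases Sym2.mem_iff.1 hb with h' | h'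
      · exact Subtype.ext (h.symm.trans h')
      · exact absurd (h.symm.trans h') (hne a b)
      · exact absurd (h'.symm.trans h) (hne b a)
      · exact hginj (h.symm.trans h')
    refine ⟨S.attach.image fun a => s(a.1, g a), ?_, ⟨?_, ?_⟩, ?_, ?_⟩
    · intro e he
      obtain ⟨a, -, rfl⟩ := Finset.mem_image.1 he
      exact hgE a
    · intro e he
      obtain ⟨a, -, rfl⟩ := Finset.mem_image.1 he
      simpa using hne a a
    · intro e he f hf hef v hv hvf
      obtain ⟨a, -, rfl⟩ := Finset.mem_image.1 he
      obtain ⟨b, -, rfl⟩ := Finset.mem_image.1 hf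
      exact hef (by rw [key a b v hv hvf])
    · rw [Finset.card_image_of_injective, Finset.card_attach]
      intro a b hab
      refine key a b a.1 (Sym2.mem_mk_left _ _) ?_
      have hab' : s(a.1, g a) = s(b.1, g b) := hab
      exact hab' ▸ Sym2.mem_mk_left a.1 (g a)
    · intro e he
      obtain ⟨a, -, rfl⟩ := Finset.mem_image.1 he
      exact ⟨a.1, a.2, g a, hgJ a, rfl⟩
  · intro A
    rcases A.eq_empty_or_nonempty with rfl | hA
    · simp
    set U := A.biUnion fun a : S => J.filter fun b => s(a.1, b) ∈ E with hU
    by_contra! hlt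
    have hUJ : U ⊆ J := Finset.biUnion_subset.2 fun a _ => Finset.filter_subset _ _
    have hsub : (A.image Subtype.val) ×ˢ (J \ U) ⊆ (S ×ˢ J).filter fun p => s(p.1, p.2) ∉ E := by
      rintro ⟨a, b⟩ hab
      rw [Finset.mem_product, Finset.mem_image, Finset.mem_sdiff] at hab
      obtain ⟨⟨a', ha', rfl⟩, hbJ, hbU⟩ := hab
      refine Finset.mem_filter.2 ⟨Finset.mem_product.2 ⟨a'.2, hbJ⟩, fun h => hbU ?_⟩
      exact Finset.mem_biUnion.2 ⟨a', ha', Finset.mem_filter.2 ⟨hbJ, h⟩⟩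
    have h1 := Finset.card_le_card hsub
    rw [Finset.card_product, Finset.card_image_of_injective _ Subtype.val_injective,
      Finset.card_sdiff_of_subset hUJ] at h1
    have h2 : A.card ≤ S.card := by
      have := Finset.card_le_univ A
      rwa [Fintype.card_coe] at this
    have h3 := hA.card_pos
    obtain ⟨p, hp⟩ := Nat.exists_eq_add_of_le (h2.trans hle)
    obtain ⟨q, hq⟩ := Nat.exists_eq_add_of_lt hlt
    have h4 : A.card * (J.card - U.card) < J.card := by omega
    rw [show J.card - U.card = p + q + 1 by omega, hp] at h4
    nlinarith [Nat.zero_le (A.card * q), Nat.mul_le_mul_right p h3]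

/-- The number of edges of `E` at the vertex `v`. -/
noncomputable def edgeDegree (E : Finset (Sym2 V)) (v : V) : ℕ := (E.filter fun e => v ∈ e).card

lemma edgeDegree_le (E : Finset (Sym2 V)) (v : V) (A : Finset V)
    (h : ∀ e ∈ E, v ∈ e → ∃ a ∈ A, e = s(v, a)) : edgeDegree E v ≤ A.card := by
  have : (E.filter fun e => v ∈ e) ⊆ A.image fun a => s(v, a) := by
    intro e he
    obtain ⟨he, hv⟩ := Finset.mem_filter.1 he
    obtain ⟨a, ha, rfl⟩ := h e he hv
    exact Finset.mem_image_of_mem _ ha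
  exact (Finset.card_le_card this).trans Finset.card_image_le

lemma injOn_insert {c : Sym2 V → ℕ} {M : Finset (Sym2 V)} (hM : Set.InjOn c M) {e : Sym2 V}
    (he : ∀ f ∈ M, c f ≠ c e) : Set.InjOn c (insert e M : Finset (Sym2 V)) := by
  intro a ha b hb hab
  rw [Finset.mem_coe, Finset.mem_insert] at ha hb
  rcases ha with rfl | ha <;> rcases hb with rfl | hb
  · rfl
  · exact absurd hab.symm (he b hb)
  · exact absurd hab (he a ha)
  · exact hM ha hb hab

lemma exists_forall_color_eq {c : Sym2 V → ℕ} (D : Finset V) (hD : 5 ≤ D.card)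
    (hc : ∀ x ∈ D, ∀ y ∈ D, ∀ z ∈ D, ∀ w ∈ D, x ≠ y → x ≠ z → x ≠ w → y ≠ z → y ≠ w → z ≠ w →
      c s(x, y) = c s(z, w)) : ∃ α, ∀ x ∈ D, ∀ y ∈ D, x ≠ y → c s(x, y) = α := by
  obtain ⟨p, hp, q, hq, hpq⟩ := Finset.one_lt_card.1 (show 1 < D.card by omega)
  have share : ∀ a ∈ D, ∀ b ∈ D, ∀ d ∈ D, a ≠ b → a ≠ d → b ≠ d → c s(a, b) = c s(a, d) := by
    intro a ha b hb d hd hab had hbd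
    have : 1 < (D \ {a, b, d}).card := by
      have h1 := Finset.le_card_sdiff ({a, b, d} : Finset V) D
      have h2 : ({a, b, d} : Finset V).card ≤ 3 := Finset.card_le_three
      omega
    obtain ⟨r, hr, t, ht, hrt⟩ := Finset.one_lt_card.1 this
    simp only [Finset.mem_sdiff, Finset.mem_insert, Finset.mem_singleton, not_or] at hr ht
    rw [hc a ha b hb r hr.1 t ht.1 hab (Ne.symm hr.2.1) (Ne.symm ht.2.1) (Ne.symm hr.2.2.1)
      (Ne.symm ht.2.2.1) hrt, hc a ha d hd r hr.1 t ht.1 had (Ne.symm hr.2.1) (Ne.symm ht.2.1)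
      (Ne.symm hr.2.2.2) (Ne.symm ht.2.2.2) hrt]
  have share' : ∀ a ∈ D, ∀ b ∈ D, ∀ d ∈ D, a ≠ b → a ≠ d → c s(a, b) = c s(a, d) := by
    intro a ha b hb d hd hab had
    by_cases hbd : b = d
    · rw [hbd]
    · exact share a ha b hb d hd hab had hbd
  refine ⟨c s(p, q), fun x hx y hy hxy => ?_⟩
  by_cases hxp : x = p
  · subst hxp
    exact share' x hx y hy q hq hxy hpq
  · rw [share' x hx y hy p hp hxy hxp, Sym2.eq_swap]
    exact share' p hp x hx q hq (Ne.symm hxp) hpq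

end Matchings

section Coloring

open Classical

variable {V : Type*} [Fintype V]

/-- `E` consists of edges with distinct colors under `c`, has more edges than the Erdős–Gallai bound
by at least two, and `c` has no rainbow matching with `m + 2` edges. -/
structure IsRainbowMatchingFree (c : Sym2 V → ℕ) (E : Finset (Sym2 V)) (m : ℕ) : Prop where
  nondiag : ∀ e ∈ E, ¬ e.IsDiag
  inj : Set.InjOn c E
  no_rainbow : ∀ M : Finset (Sym2 V), IsMatchingSet M → Set.InjOn c ↑M → M.card ≤ m + 1
  one_le : 1 ≤ m
  le_card : 2 * m + 5 ≤ Fintype.card V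
  bound_le : erdosGallaiBound (Fintype.card V) m + 2 ≤ E.card

namespace IsRainbowMatchingFree

variable {c : Sym2 V → ℕ} {E : Finset (Sym2 V)} {m : ℕ}

lemma exists_matching_avoiding (h : IsRainbowMatchingFree c E m) (α : ℕ) :
    ∃ M ⊆ E, IsMatchingSet M ∧ M.card = m + 1 ∧ ∀ e ∈ M, c e ≠ α := by
  set E' := E.filter fun e => c e ≠ α with hE'
  have hE'E : E' ⊆ E := Finset.filter_subset _ _
  have hcard : E.card ≤ E'.card + 1 := by
    rw [← Finset.card_filter_add_card_filter_not (s := E) (fun e => c e ≠ α)]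
    gcongr
    rw [Finset.card_le_one]
    intro a ha b hb
    simp only [Finset.mem_filter, not_not] at ha hb
    exact h.inj ha.1 hb.1 (ha.2.trans hb.2.symm)
  by_contra! hcon
  have := card_le_erdosGallaiBound Finset.univ E' (fun e he => h.nondiag e (hE'E he))
    (fun _ _ _ _ => Finset.mem_univ _) m (by rw [Finset.card_univ]; have := h.le_card; omega) ?_
  · rw [Finset.card_univ] at this
    have := h.bound_le
    omega
  · intro M hM hMm
    have h1 := h.no_rainbow M hMm (h.inj.mono (by exact_mod_cast hM.trans hE'E))
    by_contra! hlt
    obtain ⟨e, he, hc⟩ := hcon M (hM.trans hE'E) hMm (by omega)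
    exact (Finset.mem_filter.1 (hM he)).2 hc

lemma exists_color_eq (h : IsRainbowMatchingFree c E m) {M : Finset (Sym2 V)}
    (hMc : Set.InjOn c M) (hM : IsMatchingSet M) (hcard : M.card = m + 1) {x y : V} (hxy : x ≠ y)
    (hx : ∀ e ∈ M, x ∉ e) (hy : ∀ e ∈ M, y ∉ e) : ∃ e ∈ M, c e = c s(x, y) := by
  by_contra! hcon
  have := h.no_rainbow _ (hM.insert hxy hx hy) (injOn_insert hMc hcon)
  rw [Finset.card_insert_of_notMem] at this
  · omega
  · intro hmem
    exact hx _ hmem (Sym2.mem_mk_left x y)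

lemma card_le_of_rainbow (h : IsRainbowMatchingFree c E m) (R : Finset (Sym2 V))
    (hR : IsMatchingSet R) (hRc : Set.InjOn c R) (X : Finset V) (hX : ∀ e ∈ R, ∀ v ∈ e, v ∈ X)
    {j : ℕ} (hj : j + R.card = m + 1) (hcard : 2 * j + 2 + X.card ≤ Fintype.card V) :
    E.card ≤ R.card + ∑ v ∈ X, edgeDegree E v + erdosGallaiBound (Fintype.card V - X.card) j := by
  set E' := E.filter fun e => c e ∉ R.image c ∧ ∀ v ∈ e, v ∉ X with hE'
  have hE'E : E' ⊆ E := Finset.filter_subset _ _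
  have hcompl : Xᶜ.card = Fintype.card V - X.card := Finset.card_compl X
  have h1 : E'.card ≤ erdosGallaiBound (Fintype.card V - X.card) j := by
    rw [← hcompl]
    refine card_le_erdosGallaiBound Xᶜ E' (fun e he => h.nondiag e (hE'E he)) ?_ j ?_ ?_
    · intro e he v hv
      exact Finset.mem_compl.2 ((Finset.mem_filter.1 he).2.2 v hv)
    · omega
    · intro M hM hMm
      have hdis : ∀ e ∈ M, ∀ f ∈ R, ∀ v ∈ e, v ∉ f := fun e he f hf v hv hvf =>
        (Finset.mem_filter.1 (hM he)).2.2 v hv (hX f hf v hvf)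
      have hcol : ∀ e ∈ M, ∀ f ∈ R, c e ≠ c f := fun e he f hf hef =>
        (Finset.mem_filter.1 (hM he)).2.1 (Finset.mem_image.2 ⟨f, hf, hef.symm⟩)
      have hMc : Set.InjOn c M := h.inj.mono (by exact_mod_cast hM.trans hE'E)
      have := h.no_rainbow (M ∪ R) (hMm.union hR hdis) ?_
      · rw [Finset.card_union_of_disjoint] at this
        · omega
        · rw [Finset.disjoint_left]
          exact fun e he he' => hcol e he e he' rfl
      · intro a ha b hb hab
        rw [Finset.mem_coe, Finset.mem_union] at ha hb
        rcases ha with ha | ha <;> rcases hb with hb | hb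
        · exact hMc ha hb hab
        · exact absurd hab (hcol a ha b hb)
        · exact absurd hab.symm (hcol b hb a ha)
        · exact hRc ha hb hab
  have h2 : E ⊆ (E.filter fun e => c e ∈ R.image c) ∪ X.biUnion (fun v => E.filter fun e => v ∈ e)
      ∪ E' := by
    intro e he
    simp only [Finset.mem_union, Finset.mem_biUnion, hE', Finset.mem_filter]
    by_cases hc : c e ∈ R.image c
    · exact Or.inl (Or.inl ⟨he, hc⟩)
    · by_cases hv : ∃ v ∈ e, v ∈ X
      · obtain ⟨v, hv, hvX⟩ := hv
        exact Or.inl (Or.inr ⟨v, hvX, he, hv⟩)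
      · push Not at hv
        exact Or.inr ⟨he, hc, hv⟩
  have h3 : (E.filter fun e => c e ∈ R.image c).card ≤ R.card := by
    refine (Finset.card_le_card_of_injOn c ?_ ?_).trans (Finset.card_image_le (s := R) (f := c))
    · intro e he
      exact (Finset.mem_filter.1 he).2
    · exact h.inj.mono (by exact_mod_cast Finset.filter_subset _ _)
  have h4 : (X.biUnion fun v => E.filter fun e => v ∈ e).card ≤ ∑ v ∈ X, edgeDegree E v :=
    Finset.card_biUnion_le
  have h5 := (Finset.card_le_card h2).trans (Finset.card_union_le _ _)
  have h6 := Finset.card_union_le (E.filter fun e => c e ∈ R.image c)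
    (X.biUnion (fun v => E.filter fun e => v ∈ e))
  omega

lemma card_le_of_edge (h : IsRainbowMatchingFree c E m) {x y : V} (hxy : x ≠ y) :
    E.card ≤ 1 + (edgeDegree E x + edgeDegree E y) +
      erdosGallaiBound (Fintype.card V - 2) m := by
  have := h.card_le_of_rainbow {s(x, y)} (isMatchingSet_singleton hxy) (by simp) {x, y}
    (by simp) (j := m) (by simp) (by rw [Finset.card_pair hxy]; have := h.le_card; omega)
  rwa [Finset.card_pair hxy, Finset.sum_pair hxy, Finset.card_singleton] at this

/-- Two disjoint edges with small total degree have the same color. -/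
lemma color_eq_of_sum_edgeDegree_lt (h : IsRainbowMatchingFree c E m) {x y z w : V}
    (hxy : x ≠ y) (hxz : x ≠ z) (hxw : x ≠ w) (hyz : y ≠ z) (hyw : y ≠ w) (hzw : z ≠ w)
    (hlt : 2 + (edgeDegree E x + edgeDegree E y + edgeDegree E z + edgeDegree E w) +
      erdosGallaiBound (Fintype.card V - 4) (m - 1) < E.card) : c s(x, y) = c s(z, w) := by
  by_contra hne
  have hcard4 : ({x, y, z, w} : Finset V).card = 4 := by
    rw [Finset.card_insert_of_notMem, Finset.card_insert_of_notMem, Finset.card_pair hzw] <;>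
      simp [*]
  have hm := h.one_le
  have hcard2 : ({s(x, y), s(z, w)} : Finset (Sym2 V)).card = 2 :=
    Finset.card_pair fun h => hne (by rw [h])
  have := h.card_le_of_rainbow {s(x, y), s(z, w)} ?_ ?_ {x, y, z, w} (by simp)
    (j := m - 1) (by omega) (by have := h.le_card; omega)
  · rw [hcard4, hcard2, Finset.sum_insert, Finset.sum_insert, Finset.sum_pair hzw] at this
    · omega
    all_goals simp [*]
  · apply (isMatchingSet_singleton hzw).insert hxy <;> simp [*]
  · apply injOn_insert
    · simp
    · simpa using fun h => hne h.symm

/-- There is no large monochromatic set of vertices all of whose edges in `E` go to a small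
set. -/
lemma false_of_monochromatic (h : IsRainbowMatchingFree c E m) (I S : Finset V)
    (hdis : Disjoint I S) (hIS : ∀ x ∈ I, ∀ e ∈ E, x ∈ e → ∃ a ∈ S, e = s(x, a))
    (hcard : S.card + 2 ≤ I.card) {α : ℕ}
    (hα : ∀ x ∈ I, ∀ y ∈ I, x ≠ y → c s(x, y) = α) : False := by
  obtain ⟨M, hME, hM, hMcard, hMα⟩ := h.exists_matching_avoiding α
  have h1 := hM.card_covered_le I S hdis fun x hx e he => hIS x hx e (hME he)
  have h2 := Finset.card_filter_add_card_filter_not (s := I) (fun x => ∃ e ∈ M, x ∈ e)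
  obtain ⟨x, hx, y, hy, hxy⟩ := Finset.one_lt_card.1
    (show 1 < (I.filter fun x => ¬ ∃ e ∈ M, x ∈ e).card by omega)
  simp only [Finset.mem_filter, not_exists, not_and] at hx hy
  obtain ⟨e, he, hce⟩ := h.exists_color_eq (h.inj.mono (by exact_mod_cast hME)) hM hMcard hxy
    hx.2 hy.2
  exact hMα e he (hce.trans (hα x hx.1 y hy.1 hxy))

end IsRainbowMatchingFree

end Coloring

section Numerics

lemma erdosGallaiBound_sub_four_le {n m : ℕ} (hm : 1 ≤ m) (hn : 2 * m + 5 ≤ n) :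
    erdosGallaiBound (n - 4) (m - 1) + (4 * m - 1) ≤ erdosGallaiBound n m := by
  obtain ⟨m, rfl⟩ := Nat.exists_eq_add_of_le' hm
  obtain ⟨d, rfl⟩ := Nat.exists_eq_add_of_le hn
  unfold erdosGallaiBound
  rw [show 2 * (m + 1) + 5 + d - 4 - (m + 1 - 1) = m + 3 + d by omega,
    show 2 * (m + 1) + 5 + d - (m + 1) = m + 6 + d by omega,
    show 4 * (m + 1) - 1 = 4 * m + 3 by omega, show m + 1 - 1 = m by omega, ← max_add_add_right]
  refine max_le_max ?_ ?_
  · have h1 := two_mul_succ_choose_two (2 * m)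
    have h2 := two_mul_succ_choose_two (2 * (m + 1))
    nlinarith
  · rcases m with - | m
    · simp
      omega
    · have h1 := two_mul_succ_choose_two m
      have h2 := two_mul_succ_choose_two (m + 1)
      nlinarith

lemma erdosGallaiBound_sub_four_lt {n m s : ℕ} (hs : 1 ≤ s) (hsm : s + 1 ≤ m) (hs2 : s ≤ 2)
    (hn : 2 * m + 5 ≤ n) (hn' : s + n ≤ 2 * m + 7) :
    2 + (s + s + s + (n - 5)) + erdosGallaiBound (n - 4) (m - 1) < erdosGallaiBound n m + 2 := by
  have h := erdosGallaiBound_sub_four_le (n := n) (m := m) (by omega) hn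
  rcases le_or_gt 4 m with hm | hm
  · omega
  · have : m = 2 ∨ m = 3 := by omega
    rcases this with rfl | rfl
    · have : n = 9 ∨ n = 10 := by omega
      obtain rfl : s = 1 := by omega
      rcases this with rfl | rfl <;> simp [erdosGallaiBound, Nat.choose]
    · rcases (show s = 1 ∨ s = 2 by omega) with rfl | rfl
      · omega
      · obtain rfl : n = 11 := by omega
        simp [erdosGallaiBound, Nat.choose]

lemma erdosGallaiBound_two_mul_add_five {m : ℕ} (hm : 2 ≤ m) :
    2 + (1 + 1 + 1 + (2 * m + 1)) + erdosGallaiBound (2 * m + 5 - 4) (m - 1) <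
      erdosGallaiBound (2 * m + 5) m + 2 := by
  have h := erdosGallaiBound_sub_four_le (n := 2 * m + 5) (m := m) (by omega) le_rfl
  rcases le_or_gt 3 m with hm | hm
  · omega
  · obtain rfl : m = 2 := by omega
    simp [erdosGallaiBound, Nat.choose]

lemma barrier_bound_add_two_le {n m s : ℕ} (hs : 1 ≤ s) (hsm : s + 1 ≤ m)
    (hn : 2 * m + 2 ≤ n) :
    s.choose 2 + s * (n - s) + (2 * m - 2 * s + 1).choose 2 + 2 ≤ erdosGallaiBound n m := by
  have h1 := barrier_bound_le_max (n := n) (m := m) (s := s - 1) (by omega) hn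
  have h2 := barrier_bound_le_max (n := n) (m := m) (s := s + 1) hsm hn
  obtain ⟨s, rfl⟩ := Nat.exists_eq_add_of_le' hs
  obtain ⟨t, rfl⟩ := Nat.exists_eq_add_of_le hsm
  obtain ⟨d, rfl⟩ := Nat.exists_eq_add_of_le hn
  rw [show s + 1 - 1 = s by omega] at h1
  have e1 : 2 * (s + 1 + 1 + t) - 2 * (s + 1) + 1 = 2 * t + 2 + 1 := by omega
  have e2 : 2 * (s + 1 + 1 + t) - 2 * s + 1 = 2 * t + 4 + 1 := by omega
  have e3 : 2 * (s + 1 + 1 + t) - 2 * (s + 1 + 1) + 1 = 2 * t + 1 := by omega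
  have e4 : 2 * (s + 1 + 1 + t) + 2 + d - (s + 1) = s + 2 * t + 5 + d := by omega
  have e5 : 2 * (s + 1 + 1 + t) + 2 + d - s = s + 2 * t + 6 + d := by omega
  have e6 : 2 * (s + 1 + 1 + t) + 2 + d - (s + 1 + 1) = s + 2 * t + 4 + d := by omega
  rw [e2, e5] at h1
  rw [e3, e6] at h2
  rw [e1, e4]
  have c1 := two_mul_succ_choose_two (2 * t + 2)
  have c2 := two_mul_succ_choose_two (2 * t + 4)
  have c3 := two_mul_succ_choose_two (2 * t)
  have c4 := two_mul_succ_choose_two s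
  have c5 := two_mul_succ_choose_two (s + 1)
  have c6 : 2 * s.choose 2 + s = s * s := by
    rcases s with - | s
    · simp
    · have := two_mul_succ_choose_two s
      nlinarith
  have : 2 * ((s + 1).choose 2 + (s + 1) * (s + 2 * t + 5 + d) + (2 * t + 2 + 1).choose 2) + 3 ≤
      2 * erdosGallaiBound (2 * (s + 1 + 1 + t) + 2 + d) (s + 1 + 1 + t) := by
    nlinarith
  omega

lemma erdosGallaiBound_sub_two_lt {n m : ℕ} (hm : 1 ≤ m) (hm' : m ≤ 2) (hn : 2 * m + 5 ≤ n) :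
    1 + (m + m) + erdosGallaiBound (n - 2) m < erdosGallaiBound n m + 2 := by
  have : m = 1 ∨ m = 2 := by omega
  unfold erdosGallaiBound
  rcases this with rfl | rfl <;> simp [Nat.choose] <;> omega

lemma large_fiber_bound {n m x N : ℕ} (hm : 1 ≤ m) (hn : 2 * m + 5 ≤ n) (hx : x ≤ 2 * m)
    (hN : erdosGallaiBound n m + 2 ≤ N) (hNx : N ≤ (x + 1) * (m + 1)) :
    2 + (3 * (2 * m + 2 - x) + x) + erdosGallaiBound (n - 4) (m - 1) < N := by
  have h := erdosGallaiBound_sub_four_le hm hn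
  have h2 : m.choose 2 + m * (n - m) ≤ erdosGallaiBound n m := le_max_right _ _
  have h3 : m.choose 2 + m * (m + 5) ≤ erdosGallaiBound n m :=
    le_trans (by gcongr; omega) h2
  have h4 : (m - 1 + 1).choose 2 = m.choose 2 := by rw [Nat.sub_add_cancel hm]
  have h5 := two_mul_succ_choose_two (m - 1)
  obtain ⟨p, rfl⟩ := Nat.exists_eq_add_of_le' hm
  simp only [Nat.add_sub_cancel] at h4 h5
  have h6 : 3 * (p + 1) * (p + 1) + 9 * (p + 1) + 4 ≤ 2 * (x + 1) * (p + 2) := by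
    nlinarith
  rcases le_or_gt 3 p with hp | hp
  · have : 2 * (p + 1) + 7 < 2 * x := by
      by_contra! hcon
      have := Nat.mul_le_mul_right (p + 2) hcon
      nlinarith
    omega
  · exfalso
    interval_cases p <;> omega

end Numerics

section RainbowCases

open Classical

lemma notMem_of_forall_mem_eq {V : Type*} {M : Finset (Sym2 V)} {S J : Finset V}
    (hM : ∀ e ∈ M, ∃ a ∈ S, ∃ b ∈ J, e = s(a, b)) {x : V} (hS : x ∉ S) (hJ : x ∉ J) :
    ∀ e ∈ M, x ∉ e := by
  intro e he hmem
  obtain ⟨a, ha, b, hb, rfl⟩ := hM e he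
  rcases Sym2.mem_iff.1 hmem with rfl | rfl <;> contradiction

namespace IsRainbowMatchingFree

variable {V : Type*} [Fintype V] {c : Sym2 V → ℕ} {E : Finset (Sym2 V)} {m : ℕ}

/-- A version of `exists_matching_of_card_missing_lt` that avoids a given color. -/
lemma exists_matching_into_avoiding (h : IsRainbowMatchingFree c E m) (S J : Finset V)
    (hdis : Disjoint S J) (hle : S.card ≤ J.card)
    (hmiss : ((S ×ˢ J).filter fun p => s(p.1, p.2) ∉ E).card + 1 < J.card) (α : ℕ) :
    ∃ M ⊆ E, IsMatchingSet M ∧ M.card = S.card ∧ (∀ e ∈ M, c e ≠ α) ∧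
      ∀ e ∈ M, ∃ a ∈ S, ∃ b ∈ J, e = s(a, b) := by
  have hsub : ((S ×ˢ J).filter fun p => s(p.1, p.2) ∉ E.filter fun e => c e ≠ α) ⊆
      ((S ×ˢ J).filter fun p => s(p.1, p.2) ∉ E) ∪
      ((S ×ˢ J).filter fun p => s(p.1, p.2) ∈ E ∧ c s(p.1, p.2) = α) := by
    intro p hp
    simp only [Finset.mem_filter, Finset.mem_union] at hp ⊢
    tauto
  have hone : ((S ×ˢ J).filter fun p => s(p.1, p.2) ∈ E ∧ c s(p.1, p.2) = α).card ≤ 1 := by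
    rw [Finset.card_le_one]
    rintro ⟨a, b⟩ hp ⟨a', b'⟩ hq
    simp only [Finset.mem_filter, Finset.mem_product] at hp hq
    have := h.inj hp.2.1 hq.2.1 (hp.2.2.trans hq.2.2.symm)
    rcases Sym2.eq_iff.1 this with ⟨rfl, rfl⟩ | ⟨rfl, rfl⟩
    · rfl
    · exact absurd hp.1.1 (fun h => Finset.disjoint_left.1 hdis h hq.1.2)
  have hlt := (Finset.card_le_card hsub).trans (Finset.card_union_le _ _)
  obtain ⟨M, hME, hM, hcard, hMS⟩ := exists_matching_of_card_missing_lt S J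
    (E.filter fun e => c e ≠ α) hdis hle (by omega)
  exact ⟨M, hME.trans (Finset.filter_subset _ _), hM, hcard,
    fun e he => (Finset.mem_filter.1 (hME he)).2, hMS⟩

lemma false_of_barrier_card_eq_succ (h : IsRainbowMatchingFree c E m) (S : Finset V)
    (hS : S.card = m + 1) (hin : (edgesInside E (Finset.univ \ S)).card = 0) :
    False := by
  set T := Finset.univ \ S with hT
  have hTcard : T.card + (m + 1) = Fintype.card V := by
    rw [hT, ← hS, ← Finset.card_univ]
    exact Finset.card_sdiff_add_card_eq_card (Finset.subset_univ _)
  have hn := h.le_card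
  have hm := h.one_le
  have hsplit := card_edges_le_split Finset.univ S E h.nondiag (fun _ _ _ _ => Finset.mem_univ _)
  rw [← hT, hin, hS] at hsplit
  have hpm := Finset.card_filter_add_card_filter_not (s := S ×ˢ T) (fun p => s(p.1, p.2) ∈ E)
  rw [Finset.card_product, hS] at hpm
  have hbig := h.bound_le
  have hst : m.choose 2 + m * (Fintype.card V - m) ≤ erdosGallaiBound (Fintype.card V) m :=
    le_max_right _ _
  rw [show Fintype.card V - m = T.card + 1 by omega] at hst
  have hch : (m + 1).choose 2 = m.choose 2 + m := by
    rw [Nat.choose_succ_succ' m 1]; simp [add_comm]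
  set Q := (S ×ˢ T).filter fun p => s(p.1, p.2) ∉ E with hQ
  have hQcard : Q.card + 2 ≤ T.card := by nlinarith
  obtain ⟨x, hx, y, hy, hxy, hxyQ⟩ : ∃ x ∈ T, ∃ y ∈ T, x ≠ y ∧
      ((S ×ˢ (T \ {x, y})).filter fun p => s(p.1, p.2) ∉ E).card + 1 < (T \ {x, y}).card := by
    have hcardJ : ∀ x ∈ T, ∀ y ∈ T, x ≠ y → (T \ {x, y}).card + 2 = T.card := by
      intro x hx y hy hxy
      rw [← Finset.card_pair hxy]
      exact Finset.card_sdiff_add_card_eq_card (by simp [Finset.insert_subset_iff, hx, hy])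
    have hsubJ : ∀ x y, ((S ×ˢ (T \ {x, y})).filter fun p => s(p.1, p.2) ∉ E) ⊆
        Q.filter fun p => p.2 ≠ x ∧ p.2 ≠ y := by
      intro x y p hp
      simp only [hQ, Finset.mem_filter, Finset.mem_product, Finset.mem_sdiff, Finset.mem_insert,
        Finset.mem_singleton, not_or] at hp ⊢
      tauto
    have hTmem : ∀ p ∈ Q, p.2 ∈ T := fun p hp =>
      (Finset.mem_product.1 (Finset.mem_filter.1 hp).1).2
    rcases le_or_gt Q.card 1 with hQ1 | hQ1
    · obtain ⟨x, hx, y, hy, hxy⟩ := Finset.one_lt_card.1 (show 1 < T.card by omega)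
      refine ⟨x, hx, y, hy, hxy, ?_⟩
      have h1 := Finset.card_le_card (hsubJ x y)
      have h2 := Finset.card_filter_le Q fun p => p.2 ≠ x ∧ p.2 ≠ y
      have h3 := hcardJ x hx y hy hxy
      omega
    · obtain ⟨p, hp, q, hq, hpq⟩ := Finset.one_lt_card.1 hQ1
      obtain ⟨y, hy, hpy, hqy⟩ : ∃ y ∈ T, p.2 ≠ y ∧ (q.2 = p.2 ∨ q.2 = y) := by
        by_cases hne : p.2 = q.2
        · obtain ⟨y, hy, hyp⟩ := Finset.exists_mem_ne (show 1 < T.card by omega) p.2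
          exact ⟨y, hy, hyp.symm, Or.inl hne.symm⟩
        · exact ⟨q.2, hTmem q hq, hne, Or.inr rfl⟩
      refine ⟨p.2, hTmem p hp, y, hy, hpy, ?_⟩
      have h1 := Finset.card_le_card (hsubJ p.2 y)
      have h2 : (Q.filter fun r => r.2 ≠ p.2 ∧ r.2 ≠ y) ⊆ Q \ {p, q} := by
        intro r hr
        simp only [Finset.mem_filter, Finset.mem_sdiff, Finset.mem_insert,
          Finset.mem_singleton] at hr ⊢
        refine ⟨hr.1, ?_⟩
        rintro (rfl | rfl)
        · exact hr.2.1 rfl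
        · rcases hqy with hqy | hqy
          exacts [hr.2.1 hqy, hr.2.2 hqy]
      have h3 := Finset.card_le_card h2
      rw [Finset.card_sdiff_of_subset (by simp [Finset.insert_subset_iff, hp, hq]),
        Finset.card_pair hpq] at h3
      have h4 := hcardJ _ (hTmem p hp) y hy hpy
      omega
  have hJ : (T \ {x, y}).card + 2 = T.card := by
    rw [← Finset.card_pair hxy]
    exact Finset.card_sdiff_add_card_eq_card (by simp [Finset.insert_subset_iff, hx, hy])
  have hxS : x ∉ S := (Finset.mem_sdiff.1 hx).2
  have hyS : y ∉ S := (Finset.mem_sdiff.1 hy).2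
  obtain ⟨M, hME, hM, hMcard, hMα, hMS⟩ := h.exists_matching_into_avoiding S (T \ {x, y})
    (Finset.disjoint_left.2 fun a ha ha' => by simp [hT, ha] at ha') (by omega) hxyQ (c s(x, y))
  obtain ⟨e, he, hce⟩ := h.exists_color_eq (h.inj.mono (by exact_mod_cast hME)) hM
    (hMcard.trans hS) hxy (notMem_of_forall_mem_eq hMS hxS (by simp))
    (notMem_of_forall_mem_eq hMS hyS (by simp))
  exact hMα e he hce

lemma false_of_barrier_card_eq (h : IsRainbowMatchingFree c E m) (S I : Finset V)
    (hS : S.card = m) (hdis : Disjoint I S)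
    (hIS : ∀ x ∈ I, ∀ e ∈ E, x ∈ e → ∃ a ∈ S, e = s(x, a))
    (hI : Fintype.card V ≤ I.card + m + 3)
    (hin : (edgesInside E (Finset.univ \ S)).card ≤ 3) : False := by
  have hn := h.le_card
  have hm := h.one_le
  have hbig := h.bound_le
  obtain ⟨x, hx, y, hy, hxy⟩ := Finset.one_lt_card.1 (show 1 < I.card by omega)
  rcases le_or_gt m 2 with hm2 | hm3
  · have h1 := h.card_le_of_edge hxy
    have h2 := edgeDegree_le E x S (hIS x hx)
    have h3 := edgeDegree_le E y S (hIS y hy)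
    have h4 := erdosGallaiBound_sub_two_lt hm hm2 hn
    omega
  set T := Finset.univ \ S with hT
  have hTcard : T.card = Fintype.card V - m := by
    rw [hT, ← hS, ← Finset.card_univ]
    exact Finset.card_sdiff_of_subset (Finset.subset_univ _)
  have hsplit := card_edges_le_split Finset.univ S E h.nondiag (fun _ _ _ _ => Finset.mem_univ _)
  rw [← hT, hS] at hsplit
  have hpm := Finset.card_filter_add_card_filter_not (s := S ×ˢ T) (fun p => s(p.1, p.2) ∈ E)
  rw [Finset.card_product, hS, hTcard] at hpm
  have hst : m.choose 2 + m * (Fintype.card V - m) ≤ erdosGallaiBound (Fintype.card V) m :=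
    le_max_right _ _
  obtain ⟨t, ht, htα⟩ : ∃ t ∈ edgesInside E T, c t ≠ c s(x, y) := by
    obtain ⟨t, ht, t', ht', htt'⟩ := Finset.one_lt_card.1
      (show 1 < (edgesInside E T).card by omega)
    by_contra! hcon
    exact htt' (h.inj (mem_edgesInside.1 ht).1 (mem_edgesInside.1 ht').1
      ((hcon t ht).trans (hcon t' ht').symm))
  obtain ⟨htE, htT⟩ := mem_edgesInside.1 ht
  have htI : ∀ v ∈ I, v ∉ t := by
    intro v hv hvt
    obtain ⟨a, ha, rfl⟩ := hIS v hv t htE hvt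
    have := htT a (by simp)
    simp [hT, ha] at this
  have hIT : I ⊆ T := fun v hv => by
    simpa [hT] using Finset.disjoint_left.1 hdis hv
  have hJ : (I \ {x, y}).card + 2 = I.card := by
    rw [← Finset.card_pair hxy]
    exact Finset.card_sdiff_add_card_eq_card (by simp [Finset.insert_subset_iff, hx, hy])
  have hmissle : ((S ×ˢ (I \ {x, y})).filter fun p => s(p.1, p.2) ∉ E).card ≤
      ((S ×ˢ T).filter fun p => s(p.1, p.2) ∉ E).card :=
    Finset.card_le_card (Finset.filter_subset_filter _
      (Finset.product_subset_product_right (Finset.sdiff_subset.trans hIT)))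
  have hxS : x ∉ S := Finset.disjoint_left.1 hdis hx
  have hyS : y ∉ S := Finset.disjoint_left.1 hdis hy
  obtain ⟨M, hME, hM, hMcard, hMα, hMS⟩ := h.exists_matching_into_avoiding S (I \ {x, y})
    (hdis.symm.mono_right Finset.sdiff_subset) (by omega) (by omega) (c s(x, y))
  have htM : ∀ e ∈ M, ∀ v ∈ e, v ∉ t := by
    intro e he v hv hvt
    obtain ⟨a, ha, b, hb, rfl⟩ := hMS e he
    rcases Sym2.mem_iff.1 hv with rfl | rfl
    · have := htT v hvt
      simp [hT, ha] at this
    · exact htI v (Finset.mem_sdiff.1 hb).1 hvt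
  have hxM : ∀ e ∈ M, x ∉ e := notMem_of_forall_mem_eq hMS hxS (by simp)
  have hyM : ∀ e ∈ M, y ∉ e := notMem_of_forall_mem_eq hMS hyS (by simp)
  have hMt : (insert t M) ⊆ E := Finset.insert_subset htE hME
  have htM' : t ∉ M := fun hmem => by
    induction t using Sym2.ind with
    | _ p q => exact htM _ hmem p (by simp) (by simp)
  have hins : IsMatchingSet (insert t M) := by
    induction t using Sym2.ind with
    | _ p q =>
    refine hM.insert ?_ (fun e he hp => htM e he p hp (by simp))
      (fun e he hq => htM e he q hq (by simp))
    simpa using h.nondiag _ htE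
  have hcard : (insert t M).card = m + 1 := by
    rw [Finset.card_insert_of_notMem htM', hMcard, hS]
  obtain ⟨e, he, hce⟩ := h.exists_color_eq (h.inj.mono (by exact_mod_cast hMt)) hins hcard hxy
    (Finset.forall_mem_insert _ _ _ |>.2 ⟨htI x hx, hxM⟩)
    (Finset.forall_mem_insert _ _ _ |>.2 ⟨htI y hy, hyM⟩)
  rcases Finset.mem_insert.1 he with rfl | he
  · exact htα hce
  · exact hMα e he hce

end IsRainbowMatchingFree

end RainbowCases

section PendantCases

open Classical

namespace IsRainbowMatchingFree

variable {V : Type*} [Fintype V] {c : Sym2 V → ℕ} {E : Finset (Sym2 V)} {m : ℕ}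

lemma color_eq_of_exchange (h : IsRainbowMatchingFree c E m) (I : Finset V) (a : V) (ha : a ∉ I)
    (hIS : ∀ x ∈ I, ∀ e ∈ E, x ∈ e → e = s(x, a)) {x y z : V} (hx : x ∈ I) (hy : y ∈ I)
    (hz : z ∈ I) (hxy : x ≠ y) (hxz : x ≠ z) (hyz : y ≠ z) (hxa : s(x, a) ∈ E) :
    c s(y, z) = c s(x, a) := by
  obtain ⟨M, hME, hM, hMcard, hMα⟩ := h.exists_matching_avoiding (c s(y, z))
  have hne : ∀ v ∈ I, v ≠ a := fun v hv hva => ha (hva ▸ hv)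
  obtain ⟨e, he, hae, hxe⟩ : ∃ e ∈ M, a ∈ e ∧ x ∉ e := by
    by_contra! hcon
    obtain ⟨e, he, hce⟩ := h.exists_color_eq (h.inj.mono (by exact_mod_cast hME)) hM hMcard hyz
      (fun e he hye => by
        have h1 := hIS y hy e (hME he) hye
        have h2 := hcon e he (h1 ▸ Sym2.mem_mk_right y a)
        rw [h1, Sym2.mem_iff] at h2
        exact h2.elim hxy (hne x hx))
      (fun e he hze => by
        have h1 := hIS z hz e (hME he) hze
        have h2 := hcon e he (h1 ▸ Sym2.mem_mk_right z a)
        rw [h1, Sym2.mem_iff] at h2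
        exact h2.elim hxz (hne x hx))
    exact hMα e he hce
  have hsub : M.erase e ⊆ M := Finset.erase_subset _ _
  have haM : ∀ f ∈ M.erase e, a ∉ f := fun f hf haf =>
    Finset.ne_of_mem_erase hf (hM.eq_of_mem (hsub hf) he haf hae)
  have hIM : ∀ v ∈ I, ∀ f ∈ M.erase e, v ∉ f := fun v hv f hf hvf => by
    have := hIS v hv f (hME (hsub hf)) hvf
    exact haM f hf (this ▸ Sym2.mem_mk_right v a)
  have hmatch := (hM.mono hsub).insert (hne x hx) (hIM x hx) haM
  have hE' : insert s(x, a) (M.erase e) ⊆ E := Finset.insert_subset hxa (hsub.trans hME)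
  have hcard : (insert s(x, a) (M.erase e)).card = m + 1 := by
    rw [Finset.card_insert_of_notMem, Finset.card_erase_of_mem he]
    · omega
    · exact fun hmem => haM _ hmem (Sym2.mem_mk_right x a)
  obtain ⟨f, hf, hcf⟩ := h.exists_color_eq (h.inj.mono (by exact_mod_cast hE')) hmatch hcard hyz
    (Finset.forall_mem_insert _ _ _ |>.2 ⟨by simp [hxy.symm, hne y hy], hIM y hy⟩)
    (Finset.forall_mem_insert _ _ _ |>.2 ⟨by simp [hxz.symm, hne z hz], hIM z hz⟩)
  rcases Finset.mem_insert.1 hf with rfl | hf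
  · exact hcf.symm
  · exact absurd hcf (hMα f (hsub hf))

lemma false_of_three_pendant (h : IsRainbowMatchingFree c E m) (I : Finset V) (a : V)
    (ha : a ∉ I) (hIS : ∀ x ∈ I, ∀ e ∈ E, x ∈ e → e = s(x, a)) (hI : I.card = 3)
    (hn : Fintype.card V = 2 * m + 5) (hm : 2 ≤ m) : False := by
  have hne : ∀ v ∈ I, v ≠ a := fun v hv hva => ha (hva ▸ hv)
  have hpair : ∀ x ∈ I, ∀ y ∈ I, x ≠ y → s(x, a) ∈ E ∨ s(y, a) ∈ E := by
    intro x hx y hy hxy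
    by_contra! hcon
    obtain ⟨M, hME, hM, hMcard, hMα⟩ := h.exists_matching_avoiding (c s(x, y))
    obtain ⟨e, he, hce⟩ := h.exists_color_eq (h.inj.mono (by exact_mod_cast hME)) hM hMcard hxy
      (fun e he hxe => hcon.1 (hIS x hx e (hME he) hxe ▸ hME he))
      (fun e he hye => hcon.2 (hIS y hy e (hME he) hye ▸ hME he))
    exact hMα e he hce
  obtain ⟨x, hx, y, hy, z, hz, hxy, hxz, hyz, hxa, hya⟩ : ∃ x ∈ I, ∃ y ∈ I, ∃ z ∈ I, x ≠ y ∧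
      x ≠ z ∧ y ≠ z ∧ s(x, a) ∈ E ∧ s(y, a) ∈ E := by
    obtain ⟨p, q, r, hpq, hpr, hqr, rfl⟩ := Finset.card_eq_three.1 hI
    have h1 := hpair p (by simp) q (by simp) hpq
    have h2 := hpair p (by simp) r (by simp) hpr
    have h3 := hpair q (by simp) r (by simp) hqr
    by_cases hp : s(p, a) ∈ E
    · rcases h3 with hq | hr
      · exact ⟨p, by simp, q, by simp, r, by simp, hpq, hpr, hqr, hp, hq⟩
      · exact ⟨p, by simp, r, by simp, q, by simp, hpr, hpq, hqr.symm, hp, hr⟩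
    · exact ⟨q, by simp, r, by simp, p, by simp, hqr, hpq.symm, hpr.symm, h1.resolve_left hp,
        h2.resolve_left hp⟩
  have hyzx := h.color_eq_of_exchange I a ha hIS hx hy hz hxy hxz hyz hxa
  set W := (insert a I)ᶜ with hW
  have hWcard : W.card = 2 * m + 1 := by
    rw [hW, Finset.card_compl, Finset.card_insert_of_notMem ha, hI, hn]
    omega
  have hbig := h.bound_le
  have hle := erdosGallaiBound_sub_four_le h.one_le h.le_card
  rw [hn] at hbig hle
  have hdega : edgeDegree E a ≤ 2 * m + 4 := by
    refine (edgeDegree_le E a (Finset.univ.erase a) ?_).trans ?_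
    · intro e he hae
      obtain ⟨b, rfl⟩ := Sym2.mem_iff_exists.1 hae
      refine ⟨b, ?_, rfl⟩
      simpa using fun hb => h.nondiag _ he (by simp [hb])
    · rw [Finset.card_erase_of_mem (Finset.mem_univ _), Finset.card_univ, hn]
      omega
  have hEW : E ⊆ (E.filter fun e => a ∈ e) ∪ edgesInside E W := by
    intro e he
    rw [Finset.mem_union, Finset.mem_filter, mem_edgesInside]
    by_cases hae : a ∈ e
    · exact Or.inl ⟨he, hae⟩
    · refine Or.inr ⟨he, fun v hv => ?_⟩
      rw [hW, Finset.mem_compl, Finset.mem_insert, not_or]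
      exact ⟨fun hva => hae (hva ▸ hv),
        fun hvI => hae (hIS v hvI e he hv ▸ Sym2.mem_mk_right v a)⟩
  have hEWcard := (Finset.card_le_card hEW).trans (Finset.card_union_le _ _)
  obtain ⟨R, hRE, hR, hRcard⟩ : ∃ R ⊆ edgesInside E W, IsMatchingSet R ∧ R.card = m := by
    by_contra! hcon
    have := card_le_erdosGallaiBound W (edgesInside E W)
      (fun e he => h.nondiag e (mem_edgesInside.1 he).1) (fun e he => (mem_edgesInside.1 he).2)
      (m - 1) (by omega) ?_
    · rw [hWcard] at this
      rw [show 2 * m + 5 - 4 = 2 * m + 1 by omega] at hle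
      unfold edgeDegree at hdega
      omega
    · intro M hM hMm
      by_contra! hlt
      obtain ⟨R, hRM, hRcard⟩ := Finset.exists_subset_card_eq (show m ≤ M.card by omega)
      exact hcon R (hRM.trans hM) (hMm.mono hRM) hRcard
  obtain ⟨v, hvW, hvR⟩ : ∃ v ∈ W, v ∉ R.biUnion Sym2.toFinset := by
    refine Finset.exists_mem_notMem_of_card_lt_card ?_
    have : (R.biUnion Sym2.toFinset).card ≤ R.card * 2 := by
      refine Finset.card_biUnion_le_card_mul _ _ 2 fun e _ => ?_
      rw [Sym2.card_toFinset]
      split <;> simp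
    omega
  have hvR' : ∀ e ∈ R, v ∉ e := fun e he hv =>
    hvR (Finset.mem_biUnion.2 ⟨e, he, Sym2.mem_toFinset.2 hv⟩)
  have hvaI : v ≠ a ∧ v ∉ I := by
    rwa [hW, Finset.mem_compl, Finset.mem_insert, not_or] at hvW
  have hvne : ∀ w ∈ I, w ≠ v := fun w hw hwv => hvaI.2 (hwv ▸ hw)
  have hRW : ∀ w ∉ W, ∀ e ∈ R, w ∉ e := fun w hw e he hwe =>
    hw ((mem_edgesInside.1 (hRE he)).2 w hwe)
  have hIW : ∀ w ∈ I, w ∉ W := fun w hw => by simp [hW, hw]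
  have haW : a ∉ W := by simp [hW]
  have hdegI : ∀ w ∈ I, edgeDegree E w ≤ 1 := fun w hw => by
    have := edgeDegree_le E w {a} fun e he hwe => ⟨a, by simp, hIS w hw e he hwe⟩
    simpa using this
  have hdegv : edgeDegree E v ≤ 2 * m + 1 := by
    refine (edgeDegree_le E v (insert v I)ᶜ ?_).trans ?_
    · intro e he hve
      obtain ⟨b, rfl⟩ := Sym2.mem_iff_exists.1 hve
      refine ⟨b, ?_, rfl⟩
      rw [Finset.mem_compl, Finset.mem_insert, not_or]
      refine ⟨fun hb => h.nondiag _ he (by simp [hb]), fun hb => ?_⟩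
      have h1 := hIS b hb _ he (Sym2.mem_mk_right v b)
      have h2 : v ∈ s(b, a) := h1 ▸ Sym2.mem_mk_left v b
      rcases Sym2.mem_iff.1 h2 with h3 | h3
      exacts [hvne b hb h3.symm, hvaI.1 h3]
    · rw [Finset.card_compl, Finset.card_insert_of_notMem hvaI.2, hI, hn]
      omega
  have hxv : c s(y, z) = c s(x, v) := by
    have h1 := hdegI x hx
    have h2 := hdegI y hy
    have h3 := hdegI z hz
    have h4 := erdosGallaiBound_two_mul_add_five hm
    refine h.color_eq_of_sum_edgeDegree_lt hyz hxy.symm (hvne y hy) hxz.symm (hvne z hz)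
      (hvne x hx) ?_
    rw [hn]
    omega
  have hmatch := hR.insert (hne y hy) (hRW y (hIW y hy)) (hRW a haW)
  have hRE' : R ⊆ E := fun e he => (mem_edgesInside.1 (hRE he)).1
  have hE' : insert s(y, a) R ⊆ E := Finset.insert_subset hya hRE'
  have hcard : (insert s(y, a) R).card = m + 1 := by
    rw [Finset.card_insert_of_notMem, hRcard]
    exact fun hmem => hRW a haW _ hmem (Sym2.mem_mk_right y a)
  obtain ⟨f, hf, hcf⟩ := h.exists_color_eq (h.inj.mono (by exact_mod_cast hE')) hmatch hcard
    (hvne x hx)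
    (Finset.forall_mem_insert _ _ _ |>.2 ⟨by simp [hxy, hne x hx], hRW x (hIW x hx)⟩)
    (Finset.forall_mem_insert _ _ _ |>.2 ⟨by simp [(hvne y hy).symm, hvaI.1], hvR'⟩)
  have hfx := h.inj (hE' hf) hxa (hcf.trans (hxv.symm.trans hyzx))
  rw [hfx, Finset.mem_insert] at hf
  rcases hf with hf | hf
  · have : x ∈ s(y, a) := hf ▸ Sym2.mem_mk_left x a
    simp [hxy, hne x hx] at this
  · exact hRW a haW _ hf (Sym2.mem_mk_right x a)

lemma false_of_many_singletons (h : IsRainbowMatchingFree c E m) (S I : Finset V)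
    (hS : 1 ≤ S.card) (hSm : S.card + 1 ≤ m) (hdis : Disjoint I S)
    (hIS : ∀ x ∈ I, ∀ e ∈ E, x ∈ e → ∃ a ∈ S, e = s(x, a))
    (hI : S.card + Fintype.card V ≤ I.card + 2 * m + 3) : False := by
  have hn := h.le_card
  have hm := h.one_le
  have hbig := h.bound_le
  have hle := erdosGallaiBound_sub_four_le hm hn
  have hdeg : ∀ x ∈ I, edgeDegree E x ≤ S.card := fun x hx => edgeDegree_le E x S (hIS x hx)
  rcases (show 5 ≤ I.card ∨ I.card = 4 ∨ I.card = 3 by omega) with h5 | h4 | h3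
  · obtain ⟨α, hα⟩ := exists_forall_color_eq (c := c) I h5 (by
      intro x hx y hy z hz w hw hxy hxz hxw hyz hyw hzw
      have h1 := hdeg x hx
      have h2 := hdeg y hy
      have h3 := hdeg z hz
      have h4 := hdeg w hw
      exact h.color_eq_of_sum_edgeDegree_lt hxy hxz hxw hyz hyw hzw (by omega))
    exact h.false_of_monochromatic I S hdis hIS (by omega) hα
  · obtain ⟨v, -, hv⟩ : ∃ v ∈ Finset.univ, v ∉ S ∪ I := by
      refine Finset.exists_mem_notMem_of_card_lt_card ?_
      have := Finset.card_union_le S I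
      rw [Finset.card_univ]
      omega
    rw [Finset.mem_union, not_or] at hv
    have hdegv : edgeDegree E v ≤ Fintype.card V - 5 := by
      refine (edgeDegree_le E v (insert v I)ᶜ ?_).trans ?_
      · intro e he hve
        obtain ⟨b, rfl⟩ := Sym2.mem_iff_exists.1 hve
        refine ⟨b, ?_, rfl⟩
        rw [Finset.mem_compl, Finset.mem_insert, not_or]
        refine ⟨fun hb => h.nondiag _ he (by simp [hb]), fun hb => ?_⟩
        obtain ⟨a, ha, h1⟩ := hIS b hb _ he (Sym2.mem_mk_right v b)
        have h2 : v ∈ s(b, a) := h1 ▸ Sym2.mem_mk_left v b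
        rcases Sym2.mem_iff.1 h2 with rfl | rfl
        exacts [hv.2 hb, hv.1 ha]
      · rw [Finset.card_compl, Finset.card_insert_of_notMem hv.2, h4]
    have hlt := erdosGallaiBound_sub_four_lt (n := Fintype.card V) hS hSm (by omega) hn (by omega)
    have hd : ∀ x ∈ insert v I, edgeDegree E x ≤ Fintype.card V - 5 ∧
        (x ≠ v → edgeDegree E x ≤ S.card) := by
      intro x hx
      rcases Finset.mem_insert.1 hx with rfl | hx
      · exact ⟨hdegv, fun h => absurd rfl h⟩
      · have := hdeg x hx
        exact ⟨by omega, fun _ => this⟩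
    obtain ⟨α, hα⟩ := exists_forall_color_eq (c := c) (insert v I)
      (by rw [Finset.card_insert_of_notMem hv.2, h4]) (by
      intro x hx y hy z hz w hw hxy hxz hxw hyz hyw hzw
      refine h.color_eq_of_sum_edgeDegree_lt hxy hxz hxw hyz hyw hzw ?_
      have h1 := hd x hx
      have h2 := hd y hy
      have h3 := hd z hz
      have h4 := hd w hw
      by_cases hxv : x = v
      · have := h2.2 (fun h => hxy (hxv.trans h.symm))
        have := h3.2 (fun h => hxz (hxv.trans h.symm))
        have := h4.2 (fun h => hxw (hxv.trans h.symm))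
        omega
      · have := h1.2 hxv
        by_cases hyv : y = v
        · have := h3.2 (fun h => hyz (hyv.trans h.symm))
          have := h4.2 (fun h => hyw (hyv.trans h.symm))
          omega
        · have := h2.2 hyv
          by_cases hzv : z = v
          · have := h4.2 (fun h => hzw (hzv.trans h.symm))
            omega
          · have := h3.2 hzv
            omega)
    exact h.false_of_monochromatic I S hdis hIS (by omega) fun x hx y hy =>
      hα x (Finset.mem_insert_of_mem hx) y (Finset.mem_insert_of_mem hy)
  · obtain ⟨a, rfl⟩ := Finset.card_eq_one.1 (show S.card = 1 by omega)
    rw [Finset.card_singleton] at hI hSm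
    refine h.false_of_three_pendant I a (Finset.disjoint_singleton_right.1 hdis) ?_ h3 (by omega)
      hSm
    intro x hx e he hxe
    obtain ⟨b, hb, rfl⟩ := hIS x hx e he hxe
    rw [Finset.mem_singleton.1 hb]

end IsRainbowMatchingFree

end PendantCases

section RainbowMatchings

open Classical

lemma card_le_card_singleton_fibers_add_one {V ι : Type*} [DecidableEq ι] (T : Finset V)
    (f : V → ι) (O : Finset ι) (hO : ∀ o ∈ O, Odd (T.filter fun v => f v = o).card)
    (h : ∀ i ∈ O, ∀ j ∈ O, i ≠ j → 3 ≤ (T.filter fun v => f v = i).card →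
      (T.filter fun v => f v = j).card < 3) :
    O.card ≤ (T.filter fun v => (T.filter fun w => f w = f v).card = 1).card + 1 := by
  rw [← Finset.card_filter_add_card_filter_not (s := O)
    (fun o => (T.filter fun v => f v = o).card = 1)]
  gcongr
  · refine (Finset.card_le_card ?_).trans (Finset.card_image_le (f := f))
    intro o ho
    obtain ⟨_, ho⟩ := Finset.mem_filter.1 ho
    obtain ⟨v, hv⟩ := Finset.card_pos.1 (ho ▸ Nat.one_pos)
    obtain ⟨hvT, rfl⟩ := Finset.mem_filter.1 hv
    exact Finset.mem_image.2 ⟨v, Finset.mem_filter.2 ⟨hvT, ho⟩, rfl⟩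
  · have hbig : ∀ o ∈ O, (T.filter fun v => f v = o).card ≠ 1 →
        3 ≤ (T.filter fun v => f v = o).card := by
      intro o ho hne
      obtain ⟨r, hr⟩ := hO o ho
      omega
    rw [Finset.card_le_one]
    intro i hi j hj
    obtain ⟨hi, hi'⟩ := Finset.mem_filter.1 hi
    obtain ⟨hj, hj'⟩ := Finset.mem_filter.1 hj
    by_contra hij
    exact absurd (hbig j hj hj') (h i hi j hj hij (hbig i hi hi')).not_ge

namespace IsRainbowMatchingFree

variable {V : Type*} [Fintype V] {c : Sym2 V → ℕ} {E : Finset (Sym2 V)} {m : ℕ}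

lemma false_of_two_large_fibers {ι : Type*} [DecidableEq ι] (h : IsRainbowMatchingFree c E m)
    (f : V → ι) (hf : ∀ a b, s(a, b) ∈ E → f a = f b)
    (hX : ∑ l ∈ Finset.univ.image f, ((Finset.univ.filter fun v => f v = l).card - 1) ≤ 2 * m + 2)
    {i j : ι} (hij : i ≠ j) (hi : 3 ≤ (Finset.univ.filter fun v => f v = i).card)
    (hj : 3 ≤ (Finset.univ.filter fun v => f v = j).card) : False := by
  set x : ι → ℕ := fun l => (Finset.univ.filter fun v => f v = l).card - 1 with hx
  set L : Finset ι := Finset.univ.image f with hL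
  have hmem : ∀ v, f v ∈ L := fun v => Finset.mem_image_of_mem f (Finset.mem_univ v)
  have hmemL : ∀ l, 3 ≤ (Finset.univ.filter fun v => f v = l).card → l ∈ L := by
    intro l hl
    obtain ⟨v, hv⟩ := Finset.card_pos.1 (by omega : 0 < (Finset.univ.filter fun v => f v = l).card)
    exact (Finset.mem_filter.1 hv).2 ▸ hmem v
  obtain ⟨p, hp, hmax⟩ := Finset.exists_max_image L x ⟨i, hmemL i hi⟩
  have hpair : ∀ l ∈ L, l ≠ p → x p + x l ≤ 2 * m + 2 := by
    intro l hl hlp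
    refine le_trans ?_ hX
    rw [← Finset.add_sum_erase L _ hp]
    gcongr
    exact Finset.single_le_sum (f := x) (fun _ _ => Nat.zero_le _) (Finset.mem_erase.2 ⟨hlp, hl⟩)
  have hxp : x p ≤ 2 * m := by
    rcases eq_or_ne i p with rfl | hip
    · have := hpair j (hmemL j hj) hij.symm
      have : 2 ≤ x j := by simp only [hx]; omega
      omega
    · have := hpair i (hmemL i hi) hip
      have : 2 ≤ x i := by simp only [hx]; omega
      omega
  have hxp2 : 2 ≤ x p := by
    have := hmax i (hmemL i hi)
    have : 2 ≤ x i := by simp only [hx]; omega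
    omega
  have hdeg : ∀ v, edgeDegree E v ≤ x (f v) := by
    intro v
    have hv : v ∈ Finset.univ.filter fun w => f w = f v := by simp
    have := edgeDegree_le E v ((Finset.univ.filter fun w => f w = f v).erase v) (by
      intro e he hve
      obtain ⟨a, rfl⟩ := hve
      refine ⟨a, Finset.mem_erase.2 ⟨?_, ?_⟩, rfl⟩
      · rintro rfl
        exact h.nondiag _ he (by simp)
      · simpa using (hf _ _ he).symm)
    rwa [Finset.card_erase_of_mem hv] at this
  have hEcard : E.card ≤ (x p + 1) * (m + 1) := by
    have h1 := card_edges_inside_le Finset.univ E h.nondiag f fun a _ b _ => hf a b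
    rw [sum_fiber_choose_two, show edgesInside E Finset.univ = E by
      ext e; simp [mem_edgesInside]] at h1
    have h2 : 2 * ∑ l ∈ L, (x l + 1).choose 2 ≤ (x p + 1) * ∑ l ∈ L, x l := by
      rw [Finset.mul_sum, Finset.mul_sum]
      refine Finset.sum_le_sum fun l hl => ?_
      rw [two_mul_succ_choose_two]
      exact Nat.mul_le_mul_right _ (Nat.succ_le_succ (hmax l hl))
    have h3 : (x p + 1) * ∑ l ∈ L, x l ≤ (x p + 1) * (2 * m + 2) := Nat.mul_le_mul_left _ hX
    have h4 : (x p + 1) * (2 * m + 2) = 2 * ((x p + 1) * (m + 1)) := by ring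
    change E.card ≤ ∑ l ∈ L, (x l + 1).choose 2 at h1
    omega
  have hlarge := large_fiber_bound h.one_le h.le_card hxp h.bound_le hEcard
  set P : Finset V := Finset.univ.filter fun v => f v = p with hP
  have hPcard : P.card = x p + 1 := by
    have : x p = P.card - 1 := rfl
    omega
  have hUcard : 4 ≤ (Finset.univ \ P).card := by
    rw [Finset.card_sdiff_of_subset (Finset.subset_univ P), Finset.card_univ]
    have := h.le_card
    omega
  obtain ⟨v, hv⟩ := Finset.card_pos.1 (by omega : 0 < P.card)
  have hcol := exists_forall_color_eq (c := c) (insert v (Finset.univ \ P)) (by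
    rw [Finset.card_insert_of_notMem (by simp [hv])]
    omega)
  have hdegD : ∀ a ∈ insert v (Finset.univ \ P), edgeDegree E a ≤ x p ∧
      (a = v ∨ edgeDegree E a ≤ 2 * m + 2 - x p) := by
    intro a ha
    refine ⟨(hdeg a).trans (hmax _ (hmem a)), ?_⟩
    rcases Finset.mem_insert.1 ha with rfl | ha
    · exact Or.inl rfl
    · have h1 := hpair (f a) (hmem a) (by simpa [hP] using ha)
      have h2 := hdeg a
      right
      omega
  obtain ⟨α, hα⟩ := hcol (by
    intro a ha b hb a' ha' b' hb' hab haa' hab' hba' hbb' ha'b'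
    refine h.color_eq_of_sum_edgeDegree_lt hab haa' hab' hba' hbb' ha'b' ?_
    have h1 := hdegD a ha
    have h2 := hdegD b hb
    have h3 := hdegD a' ha'
    have h4 := hdegD b' hb'
    refine lt_of_le_of_lt ?_ hlarge
    by_cases e1 : a = v
    · have e2 : b ≠ v := fun e => hab (e1.trans e.symm)
      have e3 : a' ≠ v := fun e => haa' (e1.trans e.symm)
      have e4 : b' ≠ v := fun e => hab' (e1.trans e.symm)
      simp only [e2, e3, e4, false_or] at h2 h3 h4
      omega
    by_cases e2 : b = v
    · have e3 : a' ≠ v := fun e => hba' (e2.trans e.symm)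
      have e4 : b' ≠ v := fun e => hbb' (e2.trans e.symm)
      simp only [e1, e3, e4, false_or] at h1 h3 h4
      omega
    by_cases e3 : a' = v
    · have e4 : b' ≠ v := fun e => ha'b' (e3.trans e.symm)
      simp only [e1, e2, e4, false_or] at h1 h2 h4
      omega
    simp only [e1, e2, e3, false_or] at h1 h2 h3
    omega)
  have hsplit := card_edges_le_split Finset.univ P E h.nondiag fun _ _ _ _ => Finset.mem_univ _
  have hcross : ((P ×ˢ (Finset.univ \ P)).filter fun q => s(q.1, q.2) ∈ E) = ∅ := by
    rw [Finset.filter_eq_empty_iff]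
    rintro ⟨a, b⟩ hab hE
    obtain ⟨ha, hb⟩ := Finset.mem_product.1 hab
    have hfa : f a = p := by simpa [hP] using ha
    have hfb : f b ≠ p := by simpa [hP] using hb
    exact hfb ((hf a b hE).symm.trans hfa)
  rw [hcross, Finset.card_empty] at hsplit
  have hPch : P.card.choose 2 ≤ erdosGallaiBound (Fintype.card V) m :=
    (Nat.choose_le_choose 2 (by omega)).trans (le_max_left _ _)
  have hb := h.bound_le
  obtain ⟨e, he, e', he', hne⟩ :=
    Finset.one_lt_card.1 (by omega : 1 < (edgesInside E (Finset.univ \ P)).card)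
  have hc : ∀ e ∈ edgesInside E (Finset.univ \ P), c e = α := by
    intro e he
    obtain ⟨he, hin⟩ := mem_edgesInside.1 he
    induction e using Sym2.ind with
    | _ a b =>
    refine hα a (Finset.mem_insert_of_mem (hin a (by simp))) b
      (Finset.mem_insert_of_mem (hin b (by simp))) ?_
    rintro rfl
    exact h.nondiag _ he (by simp)
  exact hne (h.inj (mem_edgesInside.1 he).1 (mem_edgesInside.1 he').1
    ((hc e he).trans (hc e' he').symm))

theorem false (h : IsRainbowMatchingFree c E m) : False := by
  have hn := h.le_card
  have hm := h.one_le
  obtain ⟨S, -, f, O, hf, hcard, hO⟩ := exists_barrier Finset.univ E h.nondiag (m + 2)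
    (by rw [Finset.card_univ]; omega) fun M hM hM' =>
      Nat.lt_succ_of_le (h.no_rainbow M hM' (h.inj.mono (by exact_mod_cast hM)))
  rw [Finset.card_univ] at hcard
  set T : Finset V := Finset.univ \ S with hT
  have hTcard : T.card + S.card = Fintype.card V := by
    rw [hT, Finset.card_sdiff_add_card_eq_card (Finset.subset_univ S), Finset.card_univ]
  have hsplit := card_edges_le_split Finset.univ S E h.nondiag fun _ _ _ _ => Finset.mem_univ _
  rw [← hT] at hsplit
  have hinside := card_edges_inside_le T E h.nondiag f hf
  have hsum := sum_card_fiber_sub_one T f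
  rw [sum_fiber_choose_two] at hinside
  set x : Set V → ℕ := fun l => (T.filter fun v => f v = l).card - 1 with hx
  change (edgesInside E T).card ≤ ∑ l ∈ T.image f, (x l + 1).choose 2 at hinside
  change ∑ l ∈ T.image f, x l + (T.image f).card = T.card at hsum
  have hchoose := sum_succ_choose_two_le (T.image f) x
  have hOsub : O ⊆ T.image f := by
    intro o ho
    obtain ⟨v, hv⟩ := Finset.card_pos.1 (hO o ho).pos
    obtain ⟨hv, hfv⟩ := Finset.mem_filter.1 hv
    exact Finset.mem_image.2 ⟨v, hv, hfv⟩
  have hOcard := Finset.card_le_card hOsub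
  have hcross : ((S ×ˢ T).filter fun p => s(p.1, p.2) ∈ E).card ≤
      S.card * (Fintype.card V - S.card) := by
    refine (Finset.card_filter_le _ _).trans ?_
    rw [Finset.card_product, ← hTcard, Nat.add_sub_cancel]
  set I : Finset V := T.filter fun v => (T.filter fun w => f w = f v).card = 1 with hI
  have hdis : Disjoint I S := Finset.disjoint_of_subset_left (Finset.filter_subset _ _)
    Finset.sdiff_disjoint
  have hIS : ∀ v ∈ I, ∀ e ∈ E, v ∈ e → ∃ a ∈ S, e = s(v, a) := by
    intro v hv e he hve
    obtain ⟨a, rfl⟩ := hve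
    refine ⟨a, ?_, rfl⟩
    by_contra ha
    obtain ⟨hvT, hv1⟩ := Finset.mem_filter.1 hv
    have haT : a ∈ T := by simp [hT, ha]
    have hva := Finset.card_le_one.1 hv1.le v (by simp [hvT]) a
      (by simp [haT, hf v hvT a haT he])
    exact h.nondiag _ he (by simp [hva])
  have hfew : (∃ i ∈ T.image f, ∃ j ∈ T.image f, i ≠ j ∧ 2 ≤ x i ∧ 2 ≤ x j) ∨
      O.card ≤ I.card + 1 := by
    by_contra! hcon
    refine hcon.2.not_ge (card_le_card_singleton_fibers_add_one T f O hO ?_)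
    intro i hi j hj hij h3
    by_contra! h3'
    have h1 : 2 ≤ x i := by simp only [hx]; omega
    have h2 : 2 ≤ x j := by simp only [hx]; omega
    exact absurd (hcon.1 i (hOsub hi) j (hOsub hj) hij h1) h2.not_gt
  have htwo : ∀ i ∈ T.image f, ∀ j ∈ T.image f, i ≠ j →
      x i + x j ≤ ∑ l ∈ T.image f, x l := by
    intro i hi j hj hij
    rw [← Finset.add_sum_erase _ _ hi]
    gcongr
    exact Finset.single_le_sum (f := x) (fun _ _ => Nat.zero_le _)
      (Finset.mem_erase.2 ⟨hij.symm, hj⟩)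
  have hchoose_le : ∀ r, ∑ l ∈ T.image f, x l ≤ r →
      (edgesInside E T).card ≤ (r + 1).choose 2 := fun r hr =>
    hinside.trans (hchoose.trans (Nat.choose_le_choose 2 (by omega)))
  rcases (show S.card = m + 1 ∨ S.card = m ∨ S.card + 1 ≤ m by omega) with hs | hs | hs
  · exact h.false_of_barrier_card_eq_succ S hs
      (Nat.le_zero.1 (hchoose_le 0 (by omega)))
  · refine h.false_of_barrier_card_eq S I hs hdis hIS ?_ (hchoose_le 2 (by omega))
    rcases hfew with ⟨i, hi, j, hj, hij, hxi, hxj⟩ | hfew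
    · have := htwo i hi j hj hij
      omega
    · omega
  rcases hfew with ⟨i, hi, j, hj, hij, hxi, hxj⟩ | hfew
  · rcases Nat.eq_zero_or_pos S.card with hs0 | hs0
    · have hTuniv : T = Finset.univ := by rw [hT, Finset.card_eq_zero.1 hs0, Finset.sdiff_empty]
      clear_value T
      subst hTuniv
      have h1 : x i = (Finset.univ.filter fun v => f v = i).card - 1 := rfl
      have h2 : x j = (Finset.univ.filter fun v => f v = j).card - 1 := rfl
      refine h.false_of_two_large_fibers f (fun a b => hf a (by simp) b (by simp)) ?_ hij
        (by omega) (by omega)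
      change ∑ l ∈ Finset.univ.image f, x l ≤ _
      omega
    · have h1 := sum_succ_choose_two_le_of_two_le (T.image f) x hi hj hij hxi hxj
      have h2 := barrier_bound_add_two_le (n := Fintype.card V) hs0 hs (by omega)
      have h3 : (∑ l ∈ T.image f, x l - 1).choose 2 ≤ (2 * m - 2 * S.card + 1).choose 2 :=
        Nat.choose_le_choose 2 (by omega)
      have h4 := h.bound_le
      omega
  · rcases Nat.eq_zero_or_pos S.card with hs0 | hs0
    · obtain ⟨a, ha, b, hb, hab⟩ := Finset.one_lt_card.1 (by omega : 1 < I.card)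
      have hI' : ∀ v ∈ ({a, b} : Finset V), ∀ e ∈ E, v ∈ e → ∃ d ∈ (∅ : Finset V), e = s(v, d) := by
        intro v hv
        rw [← Finset.card_eq_zero.1 hs0]
        rcases Finset.mem_insert.1 hv with rfl | hv
        · exact hIS v ha
        · exact hIS v (Finset.mem_singleton.1 hv ▸ hb)
      refine h.false_of_monochromatic {a, b} ∅ (Finset.disjoint_empty_right _) hI'
        (by rw [Finset.card_pair hab, Finset.card_empty]) (α := c s(a, b)) ?_
      intro v hv w hw hvw
      simp only [Finset.mem_insert, Finset.mem_singleton] at hv hw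
      rcases hv with rfl | rfl <;> rcases hw with rfl | rfl
      · exact absurd rfl hvw
      · rfl
      · rw [Sym2.eq_swap]
      · exact absurd rfl hvw
    · exact h.false_of_many_singletons S I hs0 hs hdis hIS (by omega)

end IsRainbowMatchingFree

end RainbowMatchings

/-- Main theorem, case `n ≥ 2k+1`: for `k ≥ 3`, every edge coloring of `K_n` using at
least `ext(n, (k-1)K₂) + 2` colors contains a rainbow matching of size `k`. -/
theorem rb_main_large_n (n k : ℕ) (hk : 3 ≤ k) (hn : 2 * k + 1 ≤ n) (c : Sym2 (Fin n) → ℕ)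
    (hc : max (Nat.choose (2 * k - 3) 2) (Nat.choose (k - 2) 2 + (k - 2) * (n - k + 2)) + 2
      ≤ numColors c) :
    HasRainbowMatching c k := by
  classical
  obtain ⟨m, rfl⟩ := Nat.exists_eq_add_of_le' (show 2 ≤ k by omega)
  by_contra hcon
  obtain ⟨E, hE, hinj, himage⟩ := Finset.exists_subset_injOn_image_eq_of_surjOn (f := c)
    (((⊤ : SimpleGraph (Fin n)).edgeFinset : Finset (Sym2 (Fin n))) : Set (Sym2 (Fin n)))
    ((⊤ : SimpleGraph (Fin n)).edgeFinset.image c) (by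
      rw [Finset.coe_image]
      exact Set.surjOn_image _ _)
  have hcard : E.card = numColors c := by
    rw [← Finset.card_image_of_injOn hinj, himage, numColors]
  refine IsRainbowMatchingFree.false (c := c) (E := E) (m := m) ⟨?_, hinj, ?_, ?_, ?_, ?_⟩
  · intro e he
    simpa using hE he
  · intro M hM hMinj
    by_contra! hlt
    obtain ⟨N, hNM, hN⟩ := Finset.exists_subset_card_eq (show m + 2 ≤ M.card by omega)
    have hN' := hM.mono hNM
    exact hcon ⟨N, hN, hN'.1, hN'.2, hMinj.mono (by exact_mod_cast hNM)⟩
  · omega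
  · rw [Fintype.card_fin]
    omega
  · rw [Fintype.card_fin, hcard]
    refine le_trans (le_of_eq ?_) hc
    rw [erdosGallaiBound, show 2 * (m + 2) - 3 = 2 * m + 1 by omega, Nat.add_sub_cancel,
      show n - (m + 2) + 2 = n - m by omega]
end

section
/- (Main theorem, case n = 2k with 3 ≤ k ≤ 6) Let 3 ≤ k ≤ 6. Every edge coloring of the complete graph K_{2k} using at least (k-2 choose 2) + (k-2)(k+2) + 2 colors contains a rainbow matching of size k. -/
namespace SimpleGraph

open Finset

open scoped Classical in
/-- A finite graph of even order without a perfect matching has a set `S` of vertices and at least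
`|S| + 2` disjoint odd sets, each of which is closed under adjacency outside `S`. -/
lemma exists_odd_parts {V : Type*} [Fintype V] (G : SimpleGraph V)
    (hV : Even (Fintype.card V)) (hG : ¬ ∃ M : G.Subgraph, M.IsPerfectMatching) :
    ∃ (S : Finset V) (O : Finset (Finset V)), #S + 2 ≤ #O ∧
      (O : Set (Finset V)).PairwiseDisjoint id ∧
      ∀ F ∈ O, Odd #F ∧ Disjoint S F ∧ ∀ v ∈ F, ∀ w, G.Adj v w → w ∈ S ∨ w ∈ F := by
  rw [tutte] at hG
  push Not at hG
  obtain ⟨u, hu⟩ := hG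
  rw [IsTutteViolator] at hu
  set H := ((⊤ : G.Subgraph).deleteVerts u).coe with hH
  let Fib : H.ConnectedComponent → Finset V :=
    fun c => univ.filter fun v => ∃ x ∈ c.supp, (x : V) = v
  have hFib : ∀ c v, v ∈ Fib c ↔ ∃ x ∈ c.supp, (x : V) = v := fun c v => by simp [Fib]
  have hcard : ∀ c, #(Fib c) = c.supp.ncard := by
    intro c
    rw [← Set.ncard_image_of_injective c.supp Subtype.val_injective, ← Set.ncard_coe_finset]
    congr 1
    ext v
    simp [Fib]
  have hinj : Function.Injective Fib := by
    intro c d hcd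
    obtain ⟨x, hx⟩ := c.nonempty_supp
    have h1 : (x : V) ∈ Fib d := hcd ▸ (hFib c x).2 ⟨x, hx, rfl⟩
    obtain ⟨y, hy, hyx⟩ := (hFib d x).1 h1
    rw [Subtype.val_injective hyx] at hy
    exact hx.symm.trans hy
  refine ⟨u.toFinset, H.oddComponents.toFinset.image Fib, ?_, ?_, ?_⟩
  · rw [card_image_of_injective _ hinj, ← Set.ncard_eq_toFinset_card', ← Set.ncard_eq_toFinset_card']
    have hpar := odd_ncard_oddComponents H
    have hvert : Nat.card ((⊤ : G.Subgraph).deleteVerts u).verts + u.ncard = Fintype.card V := by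
      rw [Nat.card_coe_set_eq, Subgraph.deleteVerts_verts, Subgraph.verts_top,
        ← Nat.card_eq_fintype_card, ← Set.ncard_univ]
      exact Set.ncard_sdiff_add_ncard_of_subset (Set.subset_univ u)
    rw [Nat.odd_iff, Nat.odd_iff] at hpar
    rw [Nat.even_iff] at hV
    omega
  · intro A hA B hB hAB
    simp only [coe_image, Set.mem_image] at hA hB
    obtain ⟨c, -, rfl⟩ := hA
    obtain ⟨d, -, rfl⟩ := hB
    rw [Function.onFun, id, id, Finset.disjoint_left]
    intro v hv hv'
    obtain ⟨x, hx, rfl⟩ := (hFib c v).1 hv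
    obtain ⟨y, hy, hyx⟩ := (hFib d x).1 hv'
    rw [Subtype.val_injective hyx] at hy
    exact hAB (congrArg Fib (hx.symm.trans hy))
  · intro F hF
    simp only [mem_image, Set.mem_toFinset] at hF
    obtain ⟨c, hc, rfl⟩ := hF
    refine ⟨by rw [hcard]; exact hc, ?_, ?_⟩
    · rw [Finset.disjoint_right]
      intro v hv
      obtain ⟨x, hx, rfl⟩ := (hFib c v).1 hv
      simpa using x.2.2
    · intro v hv w hvw
      obtain ⟨x, hx, rfl⟩ := (hFib c v).1 hv
      by_cases hw : w ∈ u
      · left; simpa using hw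
      · right
        refine (hFib c w).2 ⟨⟨w, ⟨trivial, hw⟩⟩, ?_, rfl⟩
        have hadj : H.Adj x ⟨w, ⟨trivial, hw⟩⟩ := by
          have hx2 := x.2.2
          simp [hH, hvw, hw, hx2]
        rw [ConnectedComponent.mem_supp_iff] at hx ⊢
        rw [← hx]
        exact (ConnectedComponent.sound hadj.reachable).symm

/-- The right-hand side of the degree bound in `exists_barrier`. -/
def barrierBound (j s p q : ℕ) : ℕ :=
  s * (2 * j - 1) + (2 * p + 1) * (s + 2 * p) + ((s + 1) * s + (2 * s + 2) * q + 4 * q ^ 2)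

open scoped Classical in
/-- Tutte's theorem with an estimate: in a graph of order `2 * j` without a perfect matching, either
`|S| + 1` vertices have all their neighbours in `S`, or the edges are even fewer (`q ≠ 0`). -/
lemma exists_barrier {V : Type*} [Fintype V] (G : SimpleGraph V) (j : ℕ)
    (hV : Fintype.card V = 2 * j) (hG : ¬ ∃ M : G.Subgraph, M.IsPerfectMatching) :
    ∃ (S T : Finset V) (p q : ℕ), Disjoint S T ∧ #S + p + q + 1 = j ∧ (q = 0 ∨ 1 ≤ p) ∧
      ∑ v, #{w | G.Adj v w} ≤ barrierBound j #S p q ∧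
      (q = 0 → #T = #S + 1 ∧ ∀ t ∈ T, ∀ w, G.Adj t w → w ∈ S) := by
  obtain ⟨S, O, hO, hdisj, hpart⟩ := G.exists_odd_parts (hV ▸ even_two_mul j) hG
  have hne : O.Nonempty := card_pos.1 (by omega)
  obtain ⟨F₀, hF₀, hmax⟩ := exists_max_image O card hne
  obtain ⟨R, hR, hRcard⟩ := exists_subset_card_eq (s := O.erase F₀) (n := #S + 1)
    (by rw [card_erase_of_mem hF₀]; omega)
  have hRO : R ⊆ O := hR.trans (erase_subset _ _)
  have hRdisj : (R : Set (Finset V)).PairwiseDisjoint id := hdisj.subset (by exact_mod_cast hRO)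
  set T := R.biUnion id with hT
  have hST : Disjoint S T := by
    rw [hT, disjoint_biUnion_right]
    exact fun F hF => (hpart F (hRO hF)).2.1
  set P := (S ∪ T)ᶜ with hP
  set h : Finset V → ℕ := fun F => #F / 2 with hh
  have hF2 : ∀ F ∈ R, #F = 2 * h F + 1 := by
    intro F hF
    obtain ⟨m, hm⟩ := (hpart F (hRO hF)).1
    simp only [hh]
    omega
  set q := ∑ F ∈ R, h F with hq
  have hTcard : #T = 2 * q + (#S + 1) := by
    rw [hT, card_biUnion (fun A hA B hB hAB => hRdisj hA hB hAB)]
    simp only [id]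
    rw [sum_congr rfl hF2, sum_add_distrib, ← mul_sum, sum_const, hRcard]
    simp [hq]
  have hPcard : #P + (#S + #T) = 2 * j := by
    rw [hP, ← card_union_of_disjoint hST, ← hV, card_compl]
    exact Nat.sub_add_cancel (card_le_univ _)
  have hF₀P : F₀ ⊆ P := by
    intro v hv
    rw [hP, mem_compl, mem_union, not_or]
    refine ⟨fun hvS => Finset.disjoint_left.1 (hpart F₀ hF₀).2.1 hvS hv, fun hvT => ?_⟩
    obtain ⟨F, hF, hvF⟩ := mem_biUnion.1 hvT
    have hFne : F ≠ F₀ := (mem_erase.1 (hR hF)).1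
    exact Finset.disjoint_left.1 (hdisj (hRO hF) hF₀ hFne) hvF hv
  have hP0 : #F₀ ≤ #P := card_le_card hF₀P
  have hF0pos : 1 ≤ #F₀ := (hpart F₀ hF₀).1.pos
  obtain ⟨p, hp⟩ : ∃ p, #P = 2 * p + 1 := ⟨#P / 2, by omega⟩
  have hdeg : ∀ v (A : Finset V), v ∈ A → (∀ w, G.Adj v w → w ∈ S ∨ w ∈ A) →
      #{w | G.Adj v w} ≤ #S + (#A - 1) := by
    intro v A hv hA
    rw [← card_erase_of_mem hv]
    refine (card_le_card ?_).trans (card_union_le _ _)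
    intro w hw
    have hw := (mem_filter.1 hw).2
    rw [mem_union, mem_erase]
    rcases hA w hw with h1 | h1
    · exact Or.inl h1
    · exact Or.inr ⟨hw.ne', h1⟩
  refine ⟨S, T, p, q, hST, by omega, ?_, ?_, ?_⟩
  · by_contra! hcon
    obtain ⟨F, hF, hFpos⟩ := exists_ne_zero_of_sum_ne_zero (hq ▸ hcon.1)
    have := hmax F (hRO hF)
    have := hF2 F hF
    omega
  · have hS : ∑ v ∈ S, #{w | G.Adj v w} ≤ #S * (2 * j - 1) := by
      rw [← smul_eq_mul]
      refine sum_le_card_nsmul _ _ _ fun v _ => ?_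
      have := hdeg v univ (mem_univ v) (fun w _ => Or.inr (mem_univ w))
      rw [← hV]
      exact Nat.le_sub_one_of_lt (G.degree_lt_card_verts v |>.trans_eq' (by
        rw [← card_neighborFinset_eq_degree, neighborFinset_eq_filter]))
    have hPs : ∑ v ∈ P, #{w | G.Adj v w} ≤ (2 * p + 1) * (#S + 2 * p) := by
      rw [← hp, ← smul_eq_mul]
      refine sum_le_card_nsmul _ _ _ fun v hv => ?_
      refine (hdeg v P hv fun w hw => ?_).trans (by omega)
      by_contra! hcon
      have hwT : w ∈ T := by
        have := hcon.2
        rw [hP, mem_compl, not_not, mem_union] at this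
        exact this.resolve_left hcon.1
      obtain ⟨F, hF, hwF⟩ := mem_biUnion.1 hwT
      rw [hP, mem_compl, mem_union, not_or] at hv
      rcases (hpart F (hRO hF)).2.2 w hwF v hw.symm with h1 | h1
      · exact hv.1 h1
      · exact hv.2 (mem_biUnion.2 ⟨F, hF, h1⟩)
    have hTs : ∑ v ∈ T, #{w | G.Adj v w} ≤ (#S + 1) * #S + (2 * #S + 2) * q + 4 * q ^ 2 := by
      rw [hT, sum_biUnion hRdisj]
      have hle : ∀ F ∈ R, ∑ v ∈ id F, #{w | G.Adj v w} ≤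
          #S + (2 * #S + 2) * h F + 4 * (h F) ^ 2 := by
        intro F hF
        have : ∑ v ∈ F, #{w | G.Adj v w} ≤ #F * (#S + (#F - 1)) := by
          rw [← smul_eq_mul]
          exact sum_le_card_nsmul _ _ _ fun v hv => hdeg v F hv ((hpart F (hRO hF)).2.2 v hv)
        refine this.trans (le_of_eq ?_)
        rw [hF2 F hF, Nat.add_sub_cancel]
        ring
      refine (sum_le_sum hle).trans ?_
      rw [sum_add_distrib, sum_add_distrib, ← mul_sum, ← mul_sum, sum_const, hRcard, smul_eq_mul]
      gcongr
      exact sum_sq_le_sq_sum_of_nonneg fun _ _ => Nat.zero_le _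
    have hsplit (g : V → ℕ) : ∑ v, g v = ∑ v ∈ S, g v + ∑ v ∈ T, g v + ∑ v ∈ P, g v := by
      rw [← sum_union hST, hP, sum_add_sum_compl]
    rw [hsplit, barrierBound]
    omega
  · intro hq0
    refine ⟨by omega, fun t ht w hw => ?_⟩
    obtain ⟨F, hF, htF⟩ := mem_biUnion.1 ht
    have hFc := hF2 F hF
    have hF0 : h F = 0 := by
      rw [hq] at hq0
      exact (sum_eq_zero_iff.1 hq0) F hF
    rw [hF0] at hFc
    rcases (hpart F (hRO hF)).2.2 t htF w hw with h1 | h1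
    · exact h1
    · exact absurd (card_le_one.1 hFc.le t htF w h1) hw.ne

/-- The finite set `W` of vertices is perfectly matched by edges of `G`; the matching is given as a
function exchanging the ends of its edges. -/
def MatchesOn {V : Type*} (G : SimpleGraph V) (W : Finset V) : Prop :=
  ∃ f : V → V, ∀ v ∈ W, f v ∈ W ∧ f (f v) = v ∧ G.Adj v (f v)

lemma matchesOn_empty {V : Type*} (G : SimpleGraph V) : G.MatchesOn ∅ := ⟨id, by simp⟩

open scoped Classical in
lemma MatchesOn.union {V : Type*} {G : SimpleGraph V} {A B : Finset V} (hA : G.MatchesOn A)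
    (hB : G.MatchesOn B) (hAB : Disjoint A B) : G.MatchesOn (A ∪ B) := by
  obtain ⟨f, hf⟩ := hA
  obtain ⟨g, hg⟩ := hB
  refine ⟨fun v => if v ∈ A then f v else g v, fun v hv => ?_⟩
  by_cases hvA : v ∈ A
  · have := hf v hvA
    simp only [hvA, this.1, if_true, mem_union, true_or, this.2, and_self]
  · have hvB : v ∈ B := (mem_union.1 hv).resolve_left hvA
    have := hg v hvB
    have hgA : g v ∉ A := Finset.disjoint_right.1 hAB this.1
    simp only [hvA, hgA, this.1, if_false, mem_union, or_true, this.2, and_self]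

open scoped Classical in
lemma Subgraph.IsPerfectMatching.matchesOn {V : Type*} {G : SimpleGraph V} {W : Finset V}
    {M : (G.comap ((↑) : W → V)).Subgraph} (hM : M.IsPerfectMatching) : G.MatchesOn W := by
  rw [Subgraph.isPerfectMatching_iff] at hM
  choose g hg huniq using hM
  refine ⟨fun v => if h : v ∈ W then g ⟨v, h⟩ else v, fun v hv => ?_⟩
  have hgg : g (g ⟨v, hv⟩) = ⟨v, hv⟩ := (huniq _ _ (hg ⟨v, hv⟩).symm).symm
  have hadj := (hg ⟨v, hv⟩).adj_sub
  simp only [hv, dif_pos, coe_mem, Subtype.coe_eta, hgg, true_and]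
  exact hadj

open scoped Classical in
lemma exists_barrier_on {V : Type*} (G : SimpleGraph V) (W : Finset V) (j : ℕ)
    (hW : #W = 2 * j) (hG : ¬ G.MatchesOn W) :
    ∃ (S T : Finset V) (p q : ℕ), S ⊆ W ∧ T ⊆ W ∧ Disjoint S T ∧ #S + p + q + 1 = j ∧
      (q = 0 ∨ 1 ≤ p) ∧
      ∑ v ∈ W, #{w ∈ W | G.Adj v w} ≤ barrierBound j #S p q ∧
      (q = 0 → #T = #S + 1 ∧ ∀ t ∈ T, ∀ w ∈ W, G.Adj t w → w ∈ S) := by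
  obtain ⟨S, T, p, q, hST, hj, hpq, hsum, hT⟩ :=
    (G.comap ((↑) : W → V)).exists_barrier j (by simpa using hW)
      (fun ⟨M, hM⟩ => hG hM.matchesOn)
  have hmem : ∀ (A : Finset W) (v : W), (v : V) ∈ A.map (Function.Embedding.subtype _) ↔ v ∈ A :=
    fun A v => by simp
  refine ⟨S.map (Function.Embedding.subtype _), T.map (Function.Embedding.subtype _), p, q,
    map_subtype_subset S, map_subtype_subset T, (disjoint_map _).2 hST, ?_⟩
  simp only [card_map]
  refine ⟨hj, hpq, hsum.trans_eq' ?_, fun hq => ⟨(hT hq).1, fun t ht w hw htw => ?_⟩⟩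
  · rw [← sum_coe_sort W]
    refine sum_congr rfl fun v _ => ?_
    rw [← card_map (Function.Embedding.subtype _)]
    congr 1
    ext w
    simp only [mem_filter, mem_map, mem_univ, true_and, comap_adj, Function.Embedding.subtype_apply]
    constructor
    · rintro ⟨x, hx, rfl⟩
      exact ⟨x.2, hx⟩
    · rintro ⟨hw, h⟩
      exact ⟨⟨w, hw⟩, h, rfl⟩
  · obtain ⟨x, hx, rfl⟩ := mem_map.1 ht
    exact (hmem S ⟨w, hw⟩).2 ((hT hq).2 x hx ⟨w, hw⟩ htw)

open scoped Classical in
/-- A bipartite graph with parts of size `n` missing fewer than `n` edges has a perfect matching: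
one of the `n` cyclic shifts avoids the missing edges. -/
lemma matchesOn_union_of_card_lt {V : Type*} {G : SimpleGraph V} {A B : Finset V} (hAB : Disjoint A B)
    (hcard : #A = #B) (N : Finset (Sym2 V)) (hN : #N < #A)
    (hadj : ∀ a ∈ A, ∀ b ∈ B, s(a, b) ∉ N → G.Adj a b) : G.MatchesOn (A ∪ B) := by
  obtain ⟨n, hn⟩ : ∃ n, #A = n := ⟨_, rfl⟩
  have : NeZero n := ⟨by omega⟩
  let α : A ≃ Fin n := A.equivFinOfCardEq hn
  let β : B ≃ Fin n := B.equivFinOfCardEq (hcard ▸ hn)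
  obtain ⟨r, hr⟩ : ∃ r : Fin n, ∀ i, s((α.symm i : V), (β.symm (i + r) : V)) ∉ N := by
    by_contra! hcon
    choose i hi using hcon
    have hle : #(univ : Finset (Fin n)) ≤ #N := by
      refine card_le_card_of_injOn (fun r => s((α.symm (i r) : V), (β.symm (i r + r) : V)))
        (fun r _ => hi r) fun r _ r' _ h => ?_
      rcases Sym2.eq_iff.1 h with ⟨h1, h2⟩ | ⟨h1, -⟩
      · have h1 := α.symm.injective (Subtype.val_injective h1)
        have h2 := β.symm.injective (Subtype.val_injective h2)
        rw [h1] at h2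
        exact add_left_cancel h2
      · exact absurd h1 (Finset.disjoint_iff_ne.1 hAB _ (α.symm _).2 _ (β.symm _).2)
    simp at hle
    omega
  let φ : A ≃ B := α.trans ((Equiv.addRight r).trans β.symm)
  have hφ : ∀ a : A, G.Adj (a : V) (φ a : V) := fun a =>
    hadj _ a.2 _ (φ a).2 (by simpa [φ] using hr (α a))
  refine ⟨fun v => if h : v ∈ A then φ ⟨v, h⟩ else if h : v ∈ B then φ.symm ⟨v, h⟩ else v,
    fun v hv => ?_⟩
  by_cases hvA : v ∈ A
  · have h1 := Finset.disjoint_right.1 hAB (φ ⟨v, hvA⟩).2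
    simp only [hvA, dif_pos, h1, dif_neg, not_false_iff, coe_mem, Subtype.coe_eta,
      Equiv.symm_apply_apply, mem_union, or_true, true_and]
    exact hφ ⟨v, hvA⟩
  · have hvB : v ∈ B := (mem_union.1 hv).resolve_left hvA
    simp only [hvA, hvB, dif_pos, dif_neg, not_false_iff, coe_mem, Subtype.coe_eta,
      Equiv.apply_symm_apply, mem_union, true_or, true_and]
    simpa using (hφ (φ.symm ⟨v, hvB⟩)).symm

open scoped Classical in
lemma card_mul_le_sum_card_adj {V : Type*} {G : SimpleGraph V} {W : Finset V} {N : Finset (Sym2 V)}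
    (h : ∀ v ∈ W, ∀ w ∈ W, v ≠ w → s(v, w) ∉ N → G.Adj v w) :
    #W * (#W - 1) ≤ ∑ v ∈ W, #{w ∈ W | G.Adj v w} + 2 * #N := by
  have hfib : #(W.offDiag.filter fun x => s(x.1, x.2) ∈ N) ≤ 2 * #N := by
    refine card_le_mul_card_image_of_maps_to (f := fun x : V × V => s(x.1, x.2))
      (fun x hx => (mem_filter.1 hx).2) 2 fun e _ => ?_
    induction e with | _ a b =>
    refine (card_le_card (t := {(a, b), (b, a)}) fun x hx => ?_).trans card_le_two
    have := (mem_filter.1 hx).2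
    rcases x with ⟨x, y⟩
    rcases Sym2.eq_iff.1 this with ⟨rfl, rfl⟩ | ⟨rfl, rfl⟩ <;> simp
  have hsum : ∑ v ∈ W, #{w ∈ W | G.Adj v w} = #((W ×ˢ W).filter fun x => G.Adj x.1 x.2) := by
    rw [card_filter, sum_product]
    simp only [card_filter]
  have hoff : W.offDiag ⊆ ((W ×ˢ W).filter fun x => G.Adj x.1 x.2) ∪
      (W.offDiag.filter fun x => s(x.1, x.2) ∈ N) := by
    intro x hx
    have hx' := mem_offDiag.1 hx
    simp only [mem_union, mem_filter, mem_product]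
    by_cases hxN : s(x.1, x.2) ∈ N
    · exact Or.inr ⟨hx, hxN⟩
    · exact Or.inl ⟨⟨hx'.1, hx'.2.1⟩, h _ hx'.1 _ hx'.2.1 hx'.2.2 hxN⟩
  have hc := (card_le_card hoff).trans (card_union_le _ _)
  rw [offDiag_card] at hc
  rw [Nat.mul_sub_one, hsum]
  omega

open scoped Classical in
/-- If all neighbours of `T` are in `S`, then the non-edges of `G` outside the pairs that are thereby
excluded are few. -/
lemma exists_missing {V : Type*} [Fintype V] (G : SimpleGraph V) {S T : Finset V}
    (hST : Disjoint S T) (hT : ∀ t ∈ T, ∀ w, G.Adj t w → w ∈ S) :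
    ∃ N : Finset (Sym2 V),
      #N + #G.edgeFinset ≤ (Fintype.card V - #T).choose 2 + #S * #T ∧
      (∀ v ∉ T, ∀ w ∉ T, v ≠ w → s(v, w) ∉ N → G.Adj v w) ∧
      (∀ v ∈ S, ∀ t ∈ T, s(v, t) ∉ N → G.Adj v t) ∧
      ∀ e ∈ N, ∀ t ∈ T, ∀ t' ∈ T, t ∈ e → t' ∈ e → t = t' := by
  set F : Finset (Sym2 V) := Tᶜ.offDiag.image Sym2.mk.uncurry ∪ (S ×ˢ T).image Sym2.mk.uncurry
    with hF
  have hmem1 : ∀ v ∉ T, ∀ w ∉ T, v ≠ w → s(v, w) ∈ F := fun v hv w hw hvw =>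
    mem_union_left _ (mem_image.2 ⟨(v, w), by simp [hv, hw, hvw], rfl⟩)
  have hmem2 : ∀ v ∈ S, ∀ w ∈ T, s(v, w) ∈ F := fun v hv w hw =>
    mem_union_right _ (mem_image.2 ⟨(v, w), by simp [hv, hw], rfl⟩)
  have hEF : G.edgeFinset ⊆ F := by
    intro e he
    induction e with | _ a b =>
    rw [mem_edgeFinset, mem_edgeSet] at he
    by_cases ha : a ∈ T
    · rw [Sym2.eq_swap]
      exact hmem2 _ (hT a ha b he) _ ha
    · by_cases hb : b ∈ T
      · exact hmem2 _ (hT b hb a he.symm) _ hb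
      · exact hmem1 _ ha _ hb he.ne
  refine ⟨F \ G.edgeFinset, ?_, fun v hv w hw hvw h => ?_, fun v hv w hw h => ?_, ?_⟩
  · rw [card_sdiff_add_card_eq_card hEF, hF]
    refine (card_union_le _ _).trans (add_le_add (le_of_eq ?_) ?_)
    · rw [Sym2.card_image_offDiag, card_compl]
    · exact card_image_le.trans_eq (card_product _ _)
  · simpa [hmem1 v hv w hw hvw] using h
  · simpa [hmem2 v hv w hw] using h
  · intro e he t ht t' ht' hte hte'
    rcases mem_union.1 (mem_sdiff.1 he).1 with h | h
    · obtain ⟨⟨a, b⟩, hab, rfl⟩ := mem_image.1 h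
      simp only [mem_offDiag, mem_compl] at hab
      rcases Sym2.mem_iff.1 hte with rfl | rfl
      · exact absurd ht hab.1
      · exact absurd ht hab.2.1
    · obtain ⟨⟨a, b⟩, hab, rfl⟩ := mem_image.1 h
      have ha := Finset.disjoint_left.1 hST (mem_product.1 hab).1
      have h1 : t = b := (Sym2.mem_iff.1 hte).resolve_left fun h => ha (h ▸ ht)
      have h2 : t' = b := (Sym2.mem_iff.1 hte').resolve_left fun h => ha (h ▸ ht')
      rw [h1, h2]

open scoped Classical in
lemma exists_pair_covering {V : Type*} {T : Finset V} {N : Finset (Sym2 V)} (hT : 2 ≤ #T)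
    (hN : ∀ e ∈ N, ∀ t ∈ T, ∀ t' ∈ T, t ∈ e → t' ∈ e → t = t') :
    ∃ a ∈ T, ∃ b ∈ T, a ≠ b ∧
      (N.filter (fun e => ∃ t ∈ T \ {a, b}, t ∈ e) = ∅ ∨
        #(N.filter fun e => ∃ t ∈ T \ {a, b}, t ∈ e) + 2 ≤ #N) := by
  set Z := T.filter fun t => ∃ e ∈ N, t ∈ e with hZ
  rcases le_total #Z 2 with h | h
  · obtain ⟨P, hZP, hPT, hP⟩ := exists_subsuperset_card_eq (filter_subset _ T) h hT
    obtain ⟨a, b, hab, rfl⟩ := card_eq_two.1 hP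
    refine ⟨a, hPT (by simp), b, hPT (by simp), hab, Or.inl ?_⟩
    refine filter_eq_empty_iff.2 ?_
    rintro e he ⟨t, ht, hte⟩
    rw [mem_sdiff] at ht
    exact ht.2 (hZP (mem_filter.2 ⟨ht.1, e, he, hte⟩))
  · obtain ⟨P, hPZ, hP⟩ := exists_subset_card_eq h
    obtain ⟨a, b, hab, rfl⟩ := card_eq_two.1 hP
    obtain ⟨ha, e, he, hae⟩ := mem_filter.1 (hPZ (show a ∈ {a, b} by simp))
    obtain ⟨hb, f, hf, hbf⟩ := mem_filter.1 (hPZ (show b ∈ {a, b} by simp))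
    refine ⟨a, ha, b, hb, hab, Or.inr ?_⟩
    have hef : e ≠ f := by
      rintro rfl
      exact hab (hN e he a ha b hb hae hbf)
    rw [← card_pair hef, ← card_union_of_disjoint]
    · refine card_le_card (union_subset (filter_subset _ _) ?_)
      simp [insert_subset_iff, he, hf]
    · rw [Finset.disjoint_right]
      intro g hg hg'
      obtain ⟨t, ht, htg⟩ := (mem_filter.1 hg').2
      simp only [mem_sdiff, mem_insert, mem_singleton, not_or] at ht
      rcases mem_insert.1 hg with rfl | hg
      · exact ht.2.1 (hN g he t ht.1 a ha htg hae)
      · rw [mem_singleton] at hg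
        subst hg
        exact ht.2.2 (hN g hf t ht.1 b hb htg hbf)

lemma barrierBound_le {j s p q : ℕ} (hj : 2 ≤ j) (hj' : j ≤ 5) (hs : s + p + q + 1 = j)
    (hpq : q = 0 ∨ 1 ≤ p) : barrierBound j s p q ≤ (2 * j - 1) * (2 * j - 2) := by
  have : s ≤ 5 := by omega
  have : q ≤ 5 := by omega
  obtain rfl : p = j - 1 - s - q := by omega
  unfold barrierBound
  interval_cases j <;> interval_cases s <;> interval_cases q <;> simp at hs hpq ⊢

lemma barrierBound_lt_of_pos {k s p q : ℕ} (hk : 3 ≤ k) (hk' : k ≤ 6) (hs : s + p + q + 1 = k)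
    (hpq : 1 ≤ q ∧ 1 ≤ p) :
    barrierBound k s p q < 2 * (Nat.choose (k - 2) 2 + (k - 2) * (k + 2) + 2) := by
  have : s ≤ 6 := by omega
  have : q ≤ 6 := by omega
  obtain rfl : p = k - 1 - s - q := by omega
  unfold barrierBound
  interval_cases k <;> interval_cases s <;> interval_cases q <;> simp [Nat.choose_two_right] at hs hpq ⊢

lemma barrierBound_le_of_ne {k s p q : ℕ} (hk : 4 ≤ k) (hk' : k ≤ 6) (hs : s + p + q + 2 = k)
    (hpq : q = 0 ∨ 1 ≤ p) (hsq : s ≠ 0 ∨ q ≠ 0) :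
    barrierBound (k - 1) s p q ≤ 21 * k - 66 := by
  have : s ≤ 6 := by omega
  have : q ≤ 6 := by omega
  obtain rfl : p = k - 2 - s - q := by omega
  unfold barrierBound
  interval_cases k <;> interval_cases s <;> interval_cases q <;> simp at hs hpq hsq ⊢

/-- `c` has a rainbow perfect matching, given as a function exchanging the ends of its edges. -/
def HasRainbowPerfect {V : Type*} (c : Sym2 V → ℕ) : Prop :=
  ∃ f : V → V, (∀ v, f (f v) = v ∧ f v ≠ v) ∧
    ∀ v w, c s(v, f v) = c s(w, f w) → s(v, f v) = s(w, f w)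

lemma MatchesOn.hasRainbowPerfect {V : Type*} [Fintype V] {G : SimpleGraph V} {c : Sym2 V → ℕ}
    (hc : Set.InjOn c G.edgeSet) (h : G.MatchesOn univ) : HasRainbowPerfect c := by
  obtain ⟨f, hf⟩ := h
  refine ⟨f, fun v => ⟨(hf v (mem_univ v)).2.1, (hf v (mem_univ v)).2.2.ne'⟩, fun v w hvw => ?_⟩
  exact hc (hf v (mem_univ v)).2.2 (hf w (mem_univ w)).2.2 hvw

open scoped Classical in
lemma MatchesOn.hasRainbowPerfect_of_deleteEdges {V : Type*} [Fintype V] {G : SimpleGraph V}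
    {c : Sym2 V → ℕ} (hc : Set.InjOn c G.edgeSet) {a b : V} (hab : a ≠ b)
    (h : (G.deleteEdges {e | c e = c s(a, b)}).MatchesOn {a, b}ᶜ) : HasRainbowPerfect c := by
  obtain ⟨f, hf⟩ := h
  have hW : ∀ v, v ≠ a → v ≠ b → (f v ≠ a ∧ f v ≠ b) ∧ f (f v) = v ∧ G.Adj v (f v) ∧
      c s(v, f v) ≠ c s(a, b) := by
    intro v hva hvb
    simpa [hva, hvb] using hf v (by simp [hva, hvb])
  let g : V → V := fun v => if v = a then b else if v = b then a else f v
  have ha : g a = b := by simp [g]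
  have hb : g b = a := by simp [g, hab.symm]
  have hg : ∀ v, v ≠ a → v ≠ b → g v = f v := fun v hva hvb => by simp [g, hva, hvb]
  have hcases : ∀ v, s(v, g v) = s(a, b) ∨
      (G.Adj v (g v) ∧ c s(v, g v) ≠ c s(a, b)) := by
    intro v
    by_cases hva : v = a
    · subst hva
      simp [ha]
    by_cases hvb : v = b
    · subst hvb
      simp [hb, Sym2.eq_swap]
    · rw [hg v hva hvb]
      exact Or.inr (hW v hva hvb).2.2
  refine ⟨g, fun v => ?_, fun v w hvw => ?_⟩
  · by_cases hva : v = a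
    · subst hva
      simp [ha, hb, hab.symm]
    by_cases hvb : v = b
    · subst hvb
      simp [ha, hb, hab]
    · have := hW v hva hvb
      rw [hg v hva hvb, hg _ this.1.1 this.1.2]
      exact ⟨this.2.1, this.2.2.1.ne'⟩
  · rcases hcases v with hv | hv <;> rcases hcases w with hw | hw
    · rw [hv, hw]
    · rw [hv] at hvw
      exact absurd hvw.symm hw.2
    · rw [hw] at hvw
      exact absurd hvw hv.2
    · exact hc hv.1 hw.1 hvw

open scoped Classical in
/-- The edges of a rainbow graph having a prescribed color. -/
lemma exists_recolored {V : Type*} [Fintype V] {G : SimpleGraph V} {c : Sym2 V → ℕ}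
    (hc : Set.InjOn c G.edgeSet) (e : Sym2 V) :
    ∃ R : Finset (Sym2 V), #R ≤ 1 ∧
      ∀ v w, G.Adj v w → s(v, w) ∉ R → (G.deleteEdges {f | c f = c e}).Adj v w := by
  refine ⟨G.edgeFinset.filter fun f => c f = c e, card_le_one.2 fun f hf g hg => ?_,
    fun v w hvw hR => ?_⟩
  · simp only [mem_filter, mem_edgeFinset] at hf hg
    exact hc hf.1 hg.1 (hf.2.trans hg.2.symm)
  · simpa [hvw] using hR

/-- The number of colors needed for a rainbow perfect matching of `K_{2k}`, for `3 ≤ k ≤ 6`. -/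
abbrev colorThreshold (k : ℕ) : ℕ := Nat.choose (k - 2) 2 + (k - 2) * (k + 2) + 2

open scoped Classical in
lemma hasRainbowPerfect_of_isolated {V : Type*} [Fintype V] {G : SimpleGraph V} {c : Sym2 V → ℕ}
    {k : ℕ} (hk : 3 ≤ k) (hk' : k ≤ 6) (hV : Fintype.card V = 2 * k)
    (hc : Set.InjOn c G.edgeSet) (hm : colorThreshold k ≤ #G.edgeFinset) {u : V}
    (hu : ∀ w, ¬ G.Adj u w) : HasRainbowPerfect c := by
  obtain ⟨x, hx, hxmin⟩ := exists_min_image (univ.erase u) (fun v => G.degree v)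
    (card_pos.1 (by rw [card_erase_of_mem (mem_univ u), card_univ]; omega))
  have hxu : u ≠ x := (mem_erase.1 hx).1.symm
  have hdeg : (2 * k - 1) * G.degree x ≤ 2 * #G.edgeFinset := by
    rw [← G.sum_degrees_eq_twice_card_edges, ← add_sum_erase _ _ (mem_univ u), ← hV, ← card_univ,
      ← card_erase_of_mem (mem_univ u), ← smul_eq_mul]
    exact (card_nsmul_le_sum _ _ _ hxmin).trans (Nat.le_add_left _ _)
  obtain ⟨R, hR, hRadj⟩ := exists_recolored hc s(u, x)
  by_contra hno
  have hmatch := mt (MatchesOn.hasRainbowPerfect_of_deleteEdges hc hxu) hno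
  set G' := G.deleteEdges {f | c f = c s(u, x)}
  set W : Finset V := {u, x}ᶜ with hW
  have hWcard : #W = 2 * (k - 1) := by
    rw [hW, card_compl, card_pair hxu, hV]
    omega
  set F := W.offDiag.image Sym2.mk.uncurry with hF
  have hFmem : ∀ v ∈ W, ∀ w ∈ W, v ≠ w → s(v, w) ∈ F := fun v hv w hw hvw =>
    mem_image.2 ⟨(v, w), by simp [hv, hw, hvw], rfl⟩
  have hFcard : #F = (2 * (k - 1)).choose 2 := by
    rw [hF, Sym2.card_image_offDiag, hWcard]
  have hEle : #G.edgeFinset ≤ #(F ∩ G.edgeFinset) + G.degree x := by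
    rw [← card_incidenceFinset_eq_degree]
    refine (card_le_card fun e he => ?_).trans (card_union_le _ _)
    by_cases hxe : x ∈ e
    · refine mem_union_right _ ?_
      rw [mem_incidenceFinset]
      exact ⟨mem_edgeFinset.1 he, hxe⟩
    · refine mem_union_left _ (mem_inter.2 ⟨?_, he⟩)
      induction e with | _ a b =>
      rw [mem_edgeFinset, mem_edgeSet] at he
      rw [Sym2.mem_iff, not_or] at hxe
      have ha : a ≠ u := fun h => hu b (h ▸ he)
      have hb : b ≠ u := fun h => hu a (h ▸ he.symm)
      exact hFmem a (by simp [hW, ha, Ne.symm hxe.1]) b (by simp [hW, hb, Ne.symm hxe.2]) he.ne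
  have hlow := card_mul_le_sum_card_adj (G := G') (W := W) (N := F \ G.edgeFinset ∪ R)
    fun v hv w hw hvw hN => by
      rw [mem_union, not_or] at hN
      refine hRadj v w ?_ hN.2
      simpa [hFmem v hv w hw hvw] using hN.1
  have hNcard : #(F \ G.edgeFinset ∪ R) + #(F ∩ G.edgeFinset) ≤ (2 * (k - 1)).choose 2 + 1 := by
    have h1 := card_union_le (F \ G.edgeFinset) R
    have h2 := card_sdiff_add_card_inter F G.edgeFinset
    omega
  obtain ⟨S, T, p, q, -, hTW, -, hj, hpq, hsum, hT⟩ :=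
    G'.exists_barrier_on W (k - 1) hWcard hmatch
  rw [hWcard] at hlow
  have hbound := barrierBound_le (by omega) (by omega) hj hpq
  have hd : 3 ≤ G.degree x := by
    by_contra!
    unfold colorThreshold at hm
    interval_cases k <;> simp [Nat.choose_two_right] at * <;> omega
  have hk4 : 4 ≤ k := by
    by_contra!
    unfold colorThreshold at hm
    interval_cases k
    simp [Nat.choose_two_right] at *
    omega
  have hsq : #S = 0 ∧ q = 0 := by
    by_contra hcon
    have hbound' := barrierBound_le_of_ne (k := k) (s := #S) (p := p) (q := q) hk4 hk' (by omega) hpq (by omega)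
    unfold colorThreshold at hm
    interval_cases k <;> simp [Nat.choose_two_right] at * <;> omega
  obtain ⟨hT1, hTadj⟩ := hT hsq.2
  obtain ⟨y, hy⟩ := card_pos.1 (show 0 < #T by omega)
  have hyW : y ≠ u ∧ y ≠ x := by simpa [hW] using hTW hy
  have hydeg : G.degree y ≤ 2 := by
    rw [← card_incidenceFinset_eq_degree]
    refine (card_le_card (t := insert s(y, x) R) fun e he => ?_).trans
      ((card_insert_le _ _).trans (by omega))
    rw [mem_incidenceFinset] at he
    obtain ⟨z, rfl⟩ := Sym2.mem_iff_exists.1 he.2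
    have hyz : G.Adj y z := he.1
    by_cases hzx : z = x
    · simp [hzx]
    · refine mem_insert_of_mem ?_
      by_contra hzR
      have hzu : z ≠ u := fun h => hu y (h ▸ hyz.symm)
      have := hTadj y hy z (by simp [hW, hzu, hzx]) (hRadj y z hyz hzR)
      rw [card_eq_zero.1 hsq.1] at this
      exact absurd this (notMem_empty z)
  have := hxmin y (by simp [hyW.1])
  omega

open scoped Classical in
lemma hasRainbowPerfect_of_independent {V : Type*} [Fintype V] {G : SimpleGraph V} {c : Sym2 V → ℕ}
    {k : ℕ} (hk : 3 ≤ k) (hk' : k ≤ 6)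
    (hc : Set.InjOn c G.edgeSet) (hm : colorThreshold k ≤ #G.edgeFinset) {S T : Finset V}
    (hST : Disjoint S T) (hTS : T = Sᶜ) (hS : #S + 1 = k) (hT : #T = k + 1)
    (hTadj : ∀ t ∈ T, ∀ w, G.Adj t w → w ∈ S) : HasRainbowPerfect c := by
  obtain ⟨N, hN, -, hNST, hNT⟩ := G.exists_missing hST hTadj
  obtain ⟨a, ha, b, hb, hab, hcov⟩ := exists_pair_covering (by omega) hNT
  obtain ⟨R, hR, hRadj⟩ := exists_recolored hc s(a, b)
  refine MatchesOn.hasRainbowPerfect_of_deleteEdges hc hab ?_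
  have hVcard : Fintype.card V - #T = k - 1 := by
    rw [← card_compl, hTS, compl_compl]
    omega
  set N' := N.filter fun e => ∃ t ∈ T \ {a, b}, t ∈ e
  have hab2 : {a, b} ⊆ T := by simp [insert_subset_iff, ha, hb]
  have hT' : #(T \ {a, b}) = k - 1 := by
    rw [card_sdiff_of_subset hab2, card_pair hab]
    omega
  have hlt : #N' + 1 < k - 1 := by
    rcases hcov with h | h
    · rw [h, card_empty]
      omega
    · rw [hVcard, hT] at hN
      unfold colorThreshold at hm
      obtain ⟨s, hs⟩ : ∃ s, #S = s := ⟨_, rfl⟩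
      rw [hs] at hN hS
      obtain rfl : s = k - 1 := by omega
      by_contra! hle
      clear_value N'
      interval_cases k <;> norm_num [Nat.choose_two_right] at hN hm <;> omega
  have hunion : ({a, b}ᶜ : Finset V) = (T \ {a, b}) ∪ S := by
    have haS := Finset.disjoint_right.1 hST ha
    have hbS := Finset.disjoint_right.1 hST hb
    ext v
    simp only [hTS, mem_compl, mem_union, mem_sdiff]
    by_cases hvS : v ∈ S
    · simp only [hvS, mem_insert, mem_singleton, not_or, not_true, false_and, false_or, iff_true]
      exact ⟨fun h => haS (h ▸ hvS), fun h => hbS (h ▸ hvS)⟩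
    · simp [hvS]
  rw [hunion]
  refine matchesOn_union_of_card_lt (hST.symm.mono_left sdiff_subset) (by omega) (N' ∪ R)
    ((card_union_le _ _).trans_lt (by omega)) fun t ht v hv htv => ?_
  rw [mem_union, not_or] at htv
  refine hRadj t v (hNST v hv t (mem_sdiff.1 ht).1 fun h => htv.1 ?_).symm htv.2
  rw [Sym2.eq_swap] at h
  exact mem_filter.2 ⟨h, t, ht, by simp⟩

open scoped Classical in
lemma hasRainbowPerfect_of_barrier {V : Type*} [Fintype V] {G : SimpleGraph V} {c : Sym2 V → ℕ}
    {k : ℕ} (hk : 3 ≤ k) (hk' : k ≤ 6) (hV : Fintype.card V = 2 * k)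
    (hc : Set.InjOn c G.edgeSet) (hm : colorThreshold k ≤ #G.edgeFinset) {S T : Finset V}
    (hST : Disjoint S T) (hS : 1 ≤ #S) (hS' : #S + 2 ≤ k) (hT : #T = #S + 1)
    (hTadj : ∀ t ∈ T, ∀ w, G.Adj t w → w ∈ S) : HasRainbowPerfect c := by
  obtain ⟨N, hN, hNB, hNST, hNT⟩ := G.exists_missing hST hTadj
  obtain ⟨a, ha, b, hb, hab, hcov⟩ := exists_pair_covering (by omega) hNT
  obtain ⟨R, hR, hRadj⟩ := exists_recolored hc s(a, b)
  refine MatchesOn.hasRainbowPerfect_of_deleteEdges hc hab ?_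
  set G' := G.deleteEdges {f | c f = c s(a, b)}
  have hab2 : {a, b} ⊆ T := by simp [insert_subset_iff, ha, hb]
  set T' := T \ {a, b} with hT'def
  have hT' : #T' = #S - 1 := by
    rw [card_sdiff_of_subset hab2, card_pair hab]
    omega
  have hNcard : #N + 3 ≤ 2 * (k - #S) ∧ (2 ≤ #S → #N ≤ 2) := by
    rw [hV, hT] at hN
    unfold colorThreshold at hm
    obtain ⟨s, hs⟩ : ∃ s, #S = s := ⟨_, rfl⟩
    rw [hs] at hN hS hS' ⊢
    have : s ≤ 4 := by omega
    interval_cases k <;> interval_cases s <;> norm_num [Nat.choose_two_right] at hN hm <;> omega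
  have hN' : ∀ v ∈ S, ∀ t ∈ T', G.Adj v t := by
    intro v hv t ht
    refine hNST v hv t (mem_sdiff.1 ht).1 fun h => ?_
    have hmem : s(v, t) ∈ N.filter fun e => ∃ t ∈ T', t ∈ e :=
      mem_filter.2 ⟨h, t, ht, by simp⟩
    have hpos := card_pos.2 ⟨_, hmem⟩
    have hTpos := card_pos.2 ⟨t, ht⟩
    rcases hcov with h0 | h0
    · rw [h0] at hmem
      exact absurd hmem (notMem_empty _)
    · have := hNcard.2 (by omega)
      omega
  obtain ⟨x, hx, hxR⟩ : ∃ x ∈ S, ∀ v ∈ S, v ≠ x → ∀ t ∈ T', s(v, t) ∉ R := by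
    by_cases h : ∃ x ∈ S, ∃ t ∈ T', s(x, t) ∈ R
    · obtain ⟨x, hx, t, ht, hxt⟩ := h
      refine ⟨x, hx, fun v hv hvx t' ht' hvt => ?_⟩
      rcases Sym2.eq_iff.1 (card_le_one.1 hR _ hvt _ hxt) with h | h
      · exact hvx h.1
      · exact Finset.disjoint_iff_ne.1 hST _ hv _ (mem_sdiff.1 ht).1 h.1
    · push Not at h
      obtain ⟨x, hx⟩ := card_pos.1 hS
      exact ⟨x, hx, fun v hv _ t ht => h v hv t ht⟩
  set X : Finset V := insert x (S ∪ T)ᶜ with hX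
  have hxX : x ∉ (S ∪ T)ᶜ := by simp [hx]
  have hXcard : #X = 2 * (k - #S) := by
    rw [hX, card_insert_of_notMem hxX, card_compl, card_union_of_disjoint hST, hV]
    omega
  have hXT : ∀ v ∈ X, v ∉ T := by
    intro v hv
    rcases mem_insert.1 hv with rfl | hv
    · exact Finset.disjoint_left.1 hST hx
    · exact fun h => mem_compl.1 hv (mem_union_right _ h)
  have hXmatch : G'.MatchesOn X := by
    by_contra hno
    obtain ⟨S₁, -, p, q, -, -, -, hj, hpq, hsum, -⟩ := G'.exists_barrier_on X (k - #S) hXcard hno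
    have hbound := barrierBound_le (by omega) (by omega) hj hpq
    have hlow := card_mul_le_sum_card_adj (G := G') (W := X) (N := N ∪ R)
      fun v hv w hw hvw hN => by
        rw [mem_union, not_or] at hN
        exact hRadj v w (hNB v (hXT v hv) w (hXT w hw) hvw hN.1) hN.2
    have hle := card_union_le N R
    rw [hXcard] at hlow
    obtain ⟨n, hn⟩ : ∃ n, 2 * (k - #S) = n + 2 := ⟨2 * (k - #S) - 2, by omega⟩
    have hsum' := hlow.trans (Nat.add_le_add_right (hsum.trans hbound) _)
    rw [hn] at hsum' hNcard
    simp only [Nat.add_sub_cancel, show n + 2 - 1 = n + 1 by omega] at hsum'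
    nlinarith
  have hTmatch : G'.MatchesOn (T' ∪ S.erase x) := by
    have hdisj : Disjoint T' (S.erase x) :=
      (hST.symm.mono_left sdiff_subset).mono_right (erase_subset _ _)
    have hScard : #(S.erase x) = #S - 1 := card_erase_of_mem hx
    rcases Nat.eq_zero_or_pos (#S - 1) with h0 | h0
    · rw [card_eq_zero.1 (hT'.trans h0), card_eq_zero.1 (hScard.trans h0)]
      exact G'.matchesOn_empty
    · refine matchesOn_union_of_card_lt hdisj (by omega) ∅ (by rw [card_empty]; omega) fun t ht v hv _ => ?_
      obtain ⟨hvx, hvS⟩ := mem_erase.1 hv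
      exact (hRadj v t (hN' v hvS t ht) (hxR v hvS hvx t ht)).symm
  have hunion : ({a, b}ᶜ : Finset V) = (T' ∪ S.erase x) ∪ X := by
    have haS := Finset.disjoint_right.1 hST ha
    have hbS := Finset.disjoint_right.1 hST hb
    ext v
    simp only [hX, hT'def, mem_compl, mem_union, mem_sdiff, mem_erase, mem_insert, mem_singleton]
    have h1 : v = a → v ∈ T := fun h => h ▸ ha
    have h2 : v = b → v ∈ T := fun h => h ▸ hb
    have h3 : v ∈ S → v ∉ T := fun h => Finset.disjoint_left.1 hST h
    have h4 : v = x → v ∈ S := fun h => h ▸ hx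
    grind
  rw [hunion]
  refine hTmatch.union hXmatch ?_
  rw [Finset.disjoint_right]
  intro v hv hv'
  rcases mem_union.1 hv' with h | h
  · exact hXT v hv (mem_sdiff.1 h).1
  · obtain ⟨hvx, hvS⟩ := mem_erase.1 h
    rcases mem_insert.1 hv with h | h
    · exact hvx h
    · exact mem_compl.1 h (mem_union_left _ hvS)

open scoped Classical in
theorem hasRainbowPerfect_of_card_le {V : Type*} [Fintype V] {G : SimpleGraph V} {c : Sym2 V → ℕ}
    {k : ℕ} (hk : 3 ≤ k) (hk' : k ≤ 6) (hV : Fintype.card V = 2 * k)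
    (hc : Set.InjOn c G.edgeSet) (hm : colorThreshold k ≤ #G.edgeFinset) :
    HasRainbowPerfect c := by
  by_cases hG : G.MatchesOn univ
  · exact hG.hasRainbowPerfect hc
  obtain ⟨S, T, p, q, -, -, hST, hj, hpq, hsum, hT⟩ :=
    G.exists_barrier_on univ k (by rw [card_univ, hV]) hG
  have hdeg : ∑ v, #{w | G.Adj v w} = 2 * #G.edgeFinset := by
    rw [← G.sum_degrees_eq_twice_card_edges]
    simp only [← card_neighborFinset_eq_degree, neighborFinset_eq_filter]
  have hq : q = 0 := by
    by_contra hq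
    have := barrierBound_lt_of_pos hk hk' hj ⟨by omega, by omega⟩
    unfold colorThreshold at hm
    omega
  obtain ⟨hTcard, hTadj⟩ := hT hq
  replace hTadj : ∀ t ∈ T, ∀ w, G.Adj t w → w ∈ S := fun t ht w => hTadj t ht w (mem_univ w)
  rcases Nat.eq_zero_or_pos #S with hS | hS
  · obtain ⟨u, hu⟩ := card_pos.1 (show 0 < #T by omega)
    refine hasRainbowPerfect_of_isolated hk hk' hV hc hm (u := u) fun w hw => ?_
    have := hTadj u hu w hw
    rw [card_eq_zero.1 hS] at this
    exact absurd this (notMem_empty w)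
  rcases Nat.lt_or_ge (#S + 1) k with hSk | hSk
  · exact hasRainbowPerfect_of_barrier hk hk' hV hc hm hST hS hSk hTcard hTadj
  · have hSk : #S + 1 = k := by omega
    refine hasRainbowPerfect_of_independent hk hk' hc hm disjoint_compl_right rfl hSk
      (by rw [card_compl, hV]; omega) fun t ht w htw => ?_
    by_contra hwS
    have hwT : w ∉ T := fun h => mem_compl.1 ht (hTadj w h t htw.symm)
    have htT : t ∉ T := fun h => hwS (hTadj t h w htw)
    have hone : #(S ∪ T)ᶜ ≤ 1 := by
      rw [card_compl, card_union_of_disjoint hST, hV]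
      omega
    exact htw.ne (card_le_one.1 hone t (by simp [mem_compl.1 ht, htT]) w (by simp [hwS, hwT]))

end SimpleGraph

open Finset in
lemma SimpleGraph.HasRainbowPerfect.hasRainbowMatching {k : ℕ} {c : Sym2 (Fin (2 * k)) → ℕ}
    (h : SimpleGraph.HasRainbowPerfect c) : HasRainbowMatching c k := by
  obtain ⟨f, hf, hc⟩ := h
  refine ⟨univ.image fun v => s(v, f v), ?_, ?_, ?_, ?_⟩
  · have hfib : ∀ e ∈ univ.image fun v => s(v, f v), #{v | s(v, f v) = e} = 2 := by
      intro e he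
      obtain ⟨w, -, rfl⟩ := mem_image.1 he
      refine Eq.trans ?_ (card_pair (hf w).2.symm)
      congr 1
      ext v
      simp only [mem_filter, mem_univ, true_and, mem_insert, mem_singleton]
      constructor
      · intro h
        exact (Sym2.eq_iff.1 h).imp And.left And.left
      · rintro (rfl | rfl)
        · rfl
        · rw [(hf w).1, Sym2.eq_swap]
    have hsum := card_eq_sum_card_image (fun v => s(v, f v)) (univ : Finset (Fin (2 * k)))
    rw [sum_congr rfl hfib, card_univ, Fintype.card_fin, sum_const, smul_eq_mul] at hsum
    omega
  · intro e he
    obtain ⟨v, -, rfl⟩ := mem_image.1 he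
    simpa using (hf v).2.symm
  · intro e he g hg heg v hve hvg
    simp only [coe_image, coe_univ, Set.image_univ, Set.mem_range] at he hg
    obtain ⟨x, rfl⟩ := he
    obtain ⟨y, rfl⟩ := hg
    have key : ∀ w, v ∈ s(w, f w) → s(w, f w) = s(v, f v) := by
      intro w hw
      rcases Sym2.mem_iff.1 hw with rfl | rfl
      · rfl
      · rw [(hf w).1, Sym2.eq_swap]
    exact heg ((key x hve).trans (key y hvg).symm)
  · intro e he g hg heg
    simp only [coe_image, coe_univ, Set.image_univ, Set.mem_range] at he hg
    obtain ⟨x, rfl⟩ := he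
    obtain ⟨y, rfl⟩ := hg
    exact hc x y heg

/-- Main theorem, case `n = 2k` with `3 ≤ k ≤ 6`: every edge coloring of `K_{2k}` using at
least `C(k-2,2) + (k-2)(k+2) + 2` colors contains a rainbow matching of size `k`. -/
theorem rb_main_small_k (k : ℕ) (hk : 3 ≤ k) (hk' : k ≤ 6) (c : Sym2 (Fin (2 * k)) → ℕ)
    (hc : Nat.choose (k - 2) 2 + (k - 2) * (k + 2) + 2 ≤ numColors c) :
    HasRainbowMatching c k := by
  classical
  obtain ⟨E, hE, hinj, himage⟩ := Finset.exists_subset_injOn_image_eq_of_surjOn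
    ((⊤ : SimpleGraph (Fin (2 * k))).edgeFinset) (((⊤ : SimpleGraph _).edgeFinset).image c)
    (f := c) (by simp [Set.SurjOn])
  have hedge : (SimpleGraph.fromEdgeSet (E : Set (Sym2 (Fin (2 * k))))).edgeSet = E := by
    rw [SimpleGraph.edgeSet_fromEdgeSet, sdiff_eq_left, Set.disjoint_left]
    intro e he
    have := hE he
    simpa using this
  refine (SimpleGraph.hasRainbowPerfect_of_card_le
    (G := SimpleGraph.fromEdgeSet (E : Set (Sym2 (Fin (2 * k))))) hk hk' (Fintype.card_fin _)
    (by rw [hedge]; exact hinj) (hc.trans (le_of_eq ?_))).hasRainbowMatching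
  rw [numColors, ← himage, Finset.card_image_of_injOn hinj, ← Set.ncard_coe_finset,
    ← Set.ncard_coe_finset, SimpleGraph.coe_edgeFinset, hedge]
end
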